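/- arXiv:1305.4238 — 2 statements merged into one kernel-verified Lean document; each statement's English description precedes it below -/
import Mathlib

section
/- Let R be a one-dimensional Cohen–Macaulay local ring with maximal ideal m possessing a canonical module K_R, and assume that the embedding dimension equals the multiplicity: v(R) = e(R). Let I be a faithful ideal of R and set r = μ_R(I) and s = μ_R(Hom_R(I, K_R)). If rs = r(R), the Cohen–Macaulay type of R, then I ≅ R or I ≅ K_R as an R-module. -/
open CategoryTheory TensorProduct

noncomputable section

/-- Minimal number of generators of a submodule. -/
def minGen (R : Type*) {M : Type*} [Semiring R] [AddCommMonoid M] [Module R M]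
    (p : Submodule R M) : ℕ :=
  sInf {n | ∃ s : Finset M, s.card = n ∧ Submodule.span R (s : Set M) = p}

/-- Length of a module, as the height of `⊤` in its lattice of submodules. -/
def moduleLength (R M : Type*) [Ring R] [AddCommGroup M] [Module R M] : ℕ∞ :=
  Order.height (⊤ : Submodule R M)

/-- `e` is the (Hilbert–Samuel) multiplicity of the one-dimensional local ring `(R, m)`:
the first difference of the Hilbert–Samuel function `n ↦ ℓ_R(R/mⁿ)` is eventually
equal to `e`. -/
def IsMultiplicityAt (R : Type*) [CommRing R] (m : Ideal R) (e : ℕ) : Prop :=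
  ∃ N : ℕ, ∀ n ≥ N,
    moduleLength R (R ⧸ (m ^ (n + 1))) = moduleLength R (R ⧸ (m ^ n)) + e

/-- The `i`-th Ext module `Ext_R^i(M, N)`. -/
def extMod (R : Type u) [CommRing R] (M N : ModuleCat.{u} R) (i : ℕ) : ModuleCat R :=
  ((Ext R (ModuleCat.{u} R) i).obj (Opposite.op M)).obj N

/-- `K` is a canonical module of the one-dimensional Cohen–Macaulay local ring `R` with
maximal ideal `m`, via the Bass-number characterization:
`Ext^i(R/m, K) = 0` for `i ≠ 1` and `Ext^1(R/m, K) ≅ R/m`. -/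
def IsCanonicalModuleAt (R : Type u) [CommRing R] (m : Ideal R)
    (K : Type u) [AddCommGroup K] [Module R K] : Prop :=
  Module.Finite R K ∧
  (∀ i : ℕ, i ≠ 1 →
    Subsingleton (extMod R (ModuleCat.of R (R ⧸ m)) (ModuleCat.of R K) i)) ∧
  Nonempty ((extMod R (ModuleCat.of R (R ⧸ m)) (ModuleCat.of R K) 1) ≅
    ModuleCat.of R (R ⧸ m))

/-- The evaluation map `I ⊗_R Hom_R(I, K) → K`, `x ⊗ f ↦ f x`. -/
def evalMap (R : Type*) [CommRing R] {M : Type*} [AddCommGroup M] [Module R M]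
    (I : Submodule R M) (K : Type*) [AddCommGroup K] [Module R K] :
    (I ⊗[R] (I →ₗ[R] K)) →ₗ[R] K :=
  TensorProduct.lift LinearMap.applyₗ

/-- A fractional ideal `I` of `R` with `FI = F`: a finitely generated `R`-submodule of the
total ring of fractions `F = Q(R)` containing a unit of `F`. -/
def IsFracIdealUnit (R : Type*) [CommRing R] (I : Submodule R (FractionRing R)) : Prop :=
  I.FG ∧ ∃ x ∈ I, IsUnit x

/-- A one-dimensional Cohen–Macaulay local ring: Noetherian, local, Krull dimension one,
and the maximal ideal contains a nonzerodivisor. -/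
def IsOneDimCMLocal (R : Type*) [CommRing R] [IsLocalRing R] : Prop :=
  IsNoetherianRing R ∧ ringKrullDim R = 1 ∧
    ∃ x ∈ IsLocalRing.maximalIdeal R, x ∈ nonZeroDivisors R

/-- The colon `M : N = {x ∈ A | x N ⊆ M}` of two `R`-submodules of an `R`-algebra `A`,
as an `R`-submodule of `A`. -/
def colonSub {R A : Type*} [CommRing R] [CommRing A] [Algebra R A]
    (M N : Submodule R A) : Submodule R A where
  carrier := {x : A | ∀ y ∈ N, x * y ∈ M}
  add_mem' := fun {a b} ha hb y hy => by
    rw [add_mul]; exact M.add_mem (ha y hy) (hb y hy)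
  zero_mem' := fun y hy => by rw [zero_mul]; exact M.zero_mem
  smul_mem' := fun c {x} hx y hy => by
    rw [smul_mul_assoc]; exact M.smul_mem c (hx y hy)

/-- `Ext` of a module computed from a projective resolution, in terms of linear maps. -/
theorem exists_resolution_ext (R : Type u) [CommRing R] (M K : Type u) [AddCommGroup M]
    [Module R M] [AddCommGroup K] [Module R K] :
    ∃ (P₀ P₁ P₂ P₃ : ModuleCat.{u} R) (ε : P₀ →ₗ[R] M) (d₁ : P₁ →ₗ[R] P₀) (d₂ : P₂ →ₗ[R] P₁)
      (d₃ : P₃ →ₗ[R] P₂), Module.Projective R P₀ ∧ Module.Projective R P₁ ∧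
      Function.Surjective ε ∧ LinearMap.range d₁ = LinearMap.ker ε ∧
      LinearMap.range d₂ = LinearMap.ker d₁ ∧ d₂ ∘ₗ d₃ = 0 ∧
      (Subsingleton (extMod R (ModuleCat.of R M) (ModuleCat.of R K) 0) →
        ∀ φ : P₀ →ₗ[R] K, φ ∘ₗ d₁ = 0 → φ = 0) ∧
      (Subsingleton (extMod R (ModuleCat.of R M) (ModuleCat.of R K) 2) →
        ∀ φ : P₂ →ₗ[R] K, φ ∘ₗ d₃ = 0 → ∃ ψ : P₁ →ₗ[R] K, ψ ∘ₗ d₂ = φ) ∧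
      ∃ L : LinearMap.ker (LinearMap.lcomp R K d₂) →ₗ[R]
          extMod R (ModuleCat.of R M) (ModuleCat.of R K) 1, Function.Surjective L ∧
        ∀ φ, L φ = 0 → ∃ ψ : P₀ →ₗ[R] K, ψ ∘ₗ d₁ = φ.1 := by
  obtain ⟨P⟩ : Nonempty (ProjectiveResolution (ModuleCat.of R M)) := HasProjectiveResolution.out
  let Y := ModuleCat.of R K
  let C := P.complex.linearYonedaObj R Y
  have hproj (i) : Module.Projective R (P.complex.X i) :=
    (IsProjective.iff_projective (P.complex.X i)).2 (P.projective i)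
  have hsub {n : ℕ} (h : Subsingleton (extMod R (ModuleCat.of R M) Y n)) : C.ExactAt n := by
    rw [HomologicalComplex.exactAt_iff_isZero_homology]
    exact (ModuleCat.isZero_iff_subsingleton.2 h).of_iso (P.isoExt n Y).symm
  refine ⟨P.complex.X 0, P.complex.X 1, P.complex.X 2, P.complex.X 3, (P.π.f 0).hom,
    (P.complex.d 1 0).hom, (P.complex.d 2 1).hom, (P.complex.d 3 2).hom, hproj 0, hproj 1,
    ?_, ?_, ?_, ?_, ?_, ?_, ?_⟩
  · exact (ModuleCat.epi_iff_surjective (P.π.f 0)).1 inferInstance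
  · exact P.exact₀.moduleCat_range_eq_ker
  · exact (P.exact_succ 0).moduleCat_range_eq_ker
  · rw [← ModuleCat.hom_comp, P.complex.d_comp_d, ModuleCat.hom_zero]
  · intro h φ hφ
    have := (C.exactAt_iff' 0 0 1 (by simp) (by simp)).1 (hsub h)
    obtain ⟨x, hx⟩ := (ShortComplex.moduleCat_exact_iff _).1 this
      (ModuleCat.ofHom φ : P.complex.X 0 ⟶ Y)
      (show P.complex.d 1 0 ≫ ModuleCat.ofHom φ = 0 from ModuleCat.hom_ext hφ)
    have h0 : C.d 0 0 = 0 := C.shape _ _ (by simp)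
    have hx' : (C.d 0 0) x = (ModuleCat.ofHom φ : P.complex.X 0 ⟶ Y) := hx
    rw [h0] at hx'
    exact (congrArg ModuleCat.Hom.hom hx').symm
  · intro h φ hφ
    have := (C.exactAt_iff' 1 2 3 (by simp) (by simp)).1 (hsub h)
    obtain ⟨x, hx⟩ := (ShortComplex.moduleCat_exact_iff _).1 this
      (ModuleCat.ofHom φ : P.complex.X 2 ⟶ Y)
      (show P.complex.d 3 2 ≫ ModuleCat.ofHom φ = 0 from ModuleCat.hom_ext hφ)
    exact ⟨ModuleCat.Hom.hom (show P.complex.X 1 ⟶ Y from x), congrArg ModuleCat.Hom.hom hx⟩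
  · let S := C.sc' 0 1 2
    let i : extMod R (ModuleCat.of R M) Y 1 ≅ S.moduleCatLeftHomologyData.H :=
      P.isoExt 1 Y ≪≫ ShortComplex.homologyMapIso (C.isoSc' 0 1 2 (by simp) (by simp)) ≪≫
        S.moduleCatHomologyIso
    let j : LinearMap.ker (LinearMap.lcomp R K (P.complex.d 2 1).hom) →ₗ[R]
        LinearMap.ker S.g.hom :=
      { toFun := fun φ => ⟨(ModuleCat.ofHom φ.1 : P.complex.X 1 ⟶ Y),
          show P.complex.d 2 1 ≫ ModuleCat.ofHom φ.1 = 0 from ModuleCat.hom_ext φ.2⟩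
        map_add' := fun _ _ => rfl
        map_smul' := fun _ _ => rfl }
    refine ⟨i.inv.hom ∘ₗ (LinearMap.range S.moduleCatToCycles).mkQ ∘ₗ j, ?_,
      fun φ hφ => ?_⟩
    · exact i.symm.toLinearEquiv.surjective.comp ((Submodule.mkQ_surjective _).comp fun x =>
        ⟨⟨ModuleCat.Hom.hom (show P.complex.X 1 ⟶ Y from x.1),
          congrArg ModuleCat.Hom.hom (show P.complex.d 2 1 ≫ _ = 0 from x.2)⟩, rfl⟩)
    have hi (x) : i.hom (i.inv x) = x := by simp
    have h1 : ((LinearMap.range S.moduleCatToCycles).mkQ ∘ₗ j) φ = 0 :=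
      (hi _).symm.trans ((congrArg i.hom hφ).trans (map_zero i.hom.hom))
    obtain ⟨x, hx⟩ := (Submodule.Quotient.mk_eq_zero _).1 h1
    exact ⟨ModuleCat.Hom.hom (show P.complex.X 0 ⟶ Y from x),
      congrArg ModuleCat.Hom.hom (congrArg Subtype.val hx)⟩

open IsLocalRing in
/-- Elementary consequences of the Bass-number description of the canonical module `K`:
`K` has no socle, `K`-valued maps from the maximal ideal lift along `K → K / tK`, and
`Hom(𝔪, K)` modulo restrictions of homotheties embeds in the residue field. -/
theorem IsCanonicalModuleAt.elementary {R : Type u} [CommRing R] [IsLocalRing R]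
    {K : Type u} [AddCommGroup K] [Module R K]
    (hK : IsCanonicalModuleAt R (maximalIdeal R) K) :
    (∀ κ : K, (∀ a ∈ maximalIdeal R, a • κ = 0) → κ = 0) ∧
    (∀ (t : R), (∀ κ : K, t • κ = 0 → κ = 0) → ∀ (E : Type u) [AddCommGroup E] [Module R E]
      (π : K →ₗ[R] E), Function.Surjective π → (∀ κ, π κ = 0 ↔ ∃ κ', κ = t • κ') →
      ∀ g : maximalIdeal R →ₗ[R] E, ∃ h : maximalIdeal R →ₗ[R] K, π ∘ₗ h = g) ∧
    (∃ L : (maximalIdeal R →ₗ[R] K) →ₗ[R] (R ⧸ maximalIdeal R),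
      ∀ f, L f = 0 → ∃ κ : K, ∀ a, f a = (a : R) • κ) ∧
    Nontrivial K := by
  obtain ⟨-, hsub, ⟨i⟩⟩ := hK
  obtain ⟨P₀, P₁, P₂, P₃, ε, d₁, d₂, d₃, hP₀, hP₁, hε, h₁, h₂, h₃, ext0, ext2, L,
    hLsurj, hL⟩ :=
    exists_resolution_ext R (R ⧸ maximalIdeal R) K
  replace ext0 := ext0 (hsub 0 (by decide))
  replace ext2 := ext2 (hsub 2 (by decide))
  have hεd (x) : ε (d₁ x) = 0 := by
    have : d₁ x ∈ LinearMap.ker ε := h₁ ▸ ⟨x, rfl⟩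
    exact this
  have hdd (x) : d₁ (d₂ x) = 0 := by
    have : d₂ x ∈ LinearMap.ker d₁ := h₂ ▸ ⟨x, rfl⟩
    exact this
  obtain ⟨p, hp⟩ := hε (Ideal.Quotient.mk _ 1)
  obtain ⟨β, hβ⟩ := Module.projective_lifting_property (maximalIdeal R).mkQ ε
    (Submodule.mkQ_surjective _)
  have hβε (x) : Ideal.Quotient.mk (maximalIdeal R) (β x) = ε x := congr($hβ x)
  have hβm {x} (hx : ε x = 0) : β x ∈ maximalIdeal R := by
    rw [← Ideal.Quotient.eq_zero_iff_mem, hβε, hx]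
  have hunit : IsUnit (β p) := by
    by_contra h
    have h2 := Ideal.Quotient.eq_zero_iff_mem.2 ((mem_maximalIdeal _).2 h)
    rw [hβε, hp, Ideal.Quotient.eq_zero_iff_mem] at h2
    exact (Ideal.ne_top_iff_one _).1 (maximalIdeal.isMaximal R).ne_top h2
  obtain ⟨c, hc⟩ := hunit.exists_left_inv
  let β' : P₁ →ₗ[R] maximalIdeal R := (β ∘ₗ d₁).codRestrict _ fun x => hβm (hεd x)
  have hαm (a : maximalIdeal R) : (a : R) • p ∈ LinearMap.range d₁ := by
    rw [h₁, LinearMap.mem_ker, map_smul, hp]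
    change Ideal.Quotient.mk (maximalIdeal R) (a * 1) = 0
    rw [Ideal.Quotient.eq_zero_iff_mem, mul_one]
    exact a.2
  choose q hq using hαm
  have hβq (a) : β' (q a) = β p • a := by
    ext
    simp [β', hq, mul_comm]
  -- maps vanishing on the second syzygy descend to the maximal ideal
  have descend (φ : P₁ →ₗ[R] K) (hφ : φ ∘ₗ d₂ = 0) :
      ∃ h : maximalIdeal R →ₗ[R] K, ∀ a, h a = φ (q a) := by
    have key (x) (hx : d₁ x = 0) : φ x = 0 := by
      obtain ⟨y, rfl⟩ : x ∈ LinearMap.range d₂ := h₂ ▸ hx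
      exact congr($hφ y)
    have key2 (x y) (h : d₁ x = d₁ y) : φ x = φ y := by
      rw [← sub_eq_zero, ← map_sub]
      exact key _ (by rw [map_sub, h, sub_self])
    refine ⟨{ toFun := fun a => φ (q a), map_add' := fun a b => ?_, map_smul' := fun r a => ?_ },
      fun a => rfl⟩
    · rw [← map_add]
      exact key2 _ _ (by simp [hq, add_smul])
    · rw [RingHom.id_apply, ← map_smul]
      exact key2 _ _ (by simp [hq, mul_smul])
  refine ⟨fun κ hκ => ?_, fun t ht E _ _ π hπ hker g => ?_, ?_, ?_⟩
  · have := ext0 (LinearMap.toSpanSingleton R K κ ∘ₗ β) (by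
      ext x
      exact hκ _ (hβm (hεd x)))
    have h2 : β p • κ = 0 := congr($this p)
    rw [← one_smul R κ, ← hc, mul_smul, h2, smul_zero]
  · obtain ⟨φ, hφ⟩ := Module.projective_lifting_property π (g ∘ₗ β') hπ
    have hφ' (x) : π (φ x) = g (β' x) := congr($hφ x)
    have hχ (x : P₂) : ∃ κ', φ (d₂ x) = t • κ' := by
      rw [← hker, hφ']
      have : β' (d₂ x) = 0 := by
        ext
        simp [β', hdd]
      rw [this, map_zero]
    choose χ hχ using hχ
    have tinj {a b : K} (h : t • a = t • b) : a = b := by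
      rw [← sub_eq_zero] at h ⊢
      exact ht _ (by rw [smul_sub, h])
    obtain ⟨ψ, hψ⟩ := ext2
      { toFun := χ
        map_add' := fun x y => tinj (by rw [smul_add, ← hχ, ← hχ, ← hχ, map_add, map_add])
        map_smul' := fun r x => tinj (by
          rw [RingHom.id_apply, smul_comm, ← hχ, ← hχ, map_smul, map_smul]) } (by
        ext x
        apply tinj
        have h33 : d₂ (d₃ x) = 0 := congr($h₃ x)
        simp [← hχ, h33])
    obtain ⟨h, hh⟩ := descend (φ - t • ψ) (by
      ext x
      have := congr($hψ x)
      simp only [LinearMap.comp_apply, LinearMap.coe_mk, AddHom.coe_mk] at this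
      simp [hχ, this])
    refine ⟨c • h, ?_⟩
    ext a
    have h0 : π (t • ψ (q a)) = 0 := (hker _).2 ⟨_, rfl⟩
    simp only [LinearMap.comp_apply, LinearMap.smul_apply, map_smul, hh, LinearMap.sub_apply,
      LinearMap.smul_apply, map_sub, hφ', hβq]
    rw [← map_smul π, h0, sub_zero, smul_smul, hc, one_smul]
  · let j : (maximalIdeal R →ₗ[R] K) →ₗ[R] LinearMap.ker (LinearMap.lcomp R K d₂) :=
      (LinearMap.lcomp R K β').codRestrict _ fun f => by
        ext x
        have : β' (d₂ x) = 0 := by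
          ext
          simp [β', hdd]
        simp [this]
    refine ⟨i.hom.hom ∘ₗ L ∘ₗ j, fun f hf => ?_⟩
    obtain ⟨ψ, hψ⟩ := hL (j f) (by simpa using congrArg i.inv hf)
    refine ⟨c • ψ p, fun a => ?_⟩
    have h2 : ψ (d₁ (q a)) = f (β' (q a)) := congr($hψ (q a))
    rw [hq, hβq, map_smul, map_smul] at h2
    rw [smul_comm, h2, smul_smul, hc, one_smul]
  · by_contra hK0
    rw [not_nontrivial_iff_subsingleton] at hK0
    have hL0 : Subsingleton (extMod R (ModuleCat.of R (R ⧸ maximalIdeal R))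
      (ModuleCat.of R K) 1) := by
      have : Subsingleton (P₁ →ₗ[R] K) := ⟨fun f g => LinearMap.ext fun _ => Subsingleton.elim _ _⟩
      exact hLsurj.subsingleton
    have := i.symm.toLinearEquiv.toEquiv.subsingleton
    have h3 : Nontrivial (R ⧸ maximalIdeal R) :=
      Ideal.Quotient.nontrivial_iff.2 (maximalIdeal.isMaximal R).ne_top
    exact not_subsingleton _ this

open IsLocalRing

/-- A linear map out of `A` factors through a surjection whose kernel it kills. -/
theorem LinearMap.exists_factor_of_ker_le {R A B C : Type*} [Ring R] [AddCommGroup A]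
    [AddCommGroup B] [AddCommGroup C] [Module R A] [Module R B] [Module R C] {f : A →ₗ[R] B}
    (hf : Function.Surjective f) {g : A →ₗ[R] C} (h : ∀ x, f x = 0 → g x = 0) :
    ∃ F : B →ₗ[R] C, ∀ x, F (f x) = g x :=
  ⟨(LinearMap.ker f).liftQ g h ∘ₗ (f.quotKerEquivOfSurjective hf).symm.toLinearMap, fun x => by
    have : (f.quotKerEquivOfSurjective hf).symm (f x) = Submodule.Quotient.mk x := by
      rw [LinearEquiv.symm_apply_eq]
      rfl
    rw [LinearMap.comp_apply, LinearEquiv.coe_coe, this]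
    rfl⟩

section Duality

variable {R : Type u} [CommRing R] [IsLocalRing R]

/-- The socle of a module over a local ring. -/
def socle (R : Type*) [CommRing R] [IsLocalRing R] (N : Type*) [AddCommGroup N] [Module R N] :
    Submodule R N :=
  Submodule.torsionBySet R N (maximalIdeal R)

theorem mem_socle {N : Type*} [AddCommGroup N] [Module R N] {x : N} :
    x ∈ socle R N ↔ ∀ a ∈ maximalIdeal R, a • x = 0 := by
  simp [socle, Submodule.mem_torsionBySet_iff]

theorem IsSimpleModule.smul_eq_zero_of_mem_maximalIdeal {S : Type*} [AddCommGroup S] [Module R S]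
    [IsSimpleModule R S] {a : R} (ha : a ∈ maximalIdeal R) (x : S) : a • x = 0 := by
  have h := IsLocalRing.eq_maximalIdeal (IsSimpleModule.annihilator_isMaximal (R := R) (M := S))
  rw [← h] at ha
  exact Module.mem_annihilator.1 ha x

/-- A nonzero Artinian module over a local ring has nonzero socle. -/
theorem exists_ne_zero_mem_socle (N : Type*) [AddCommGroup N] [Module R N] [IsArtinian R N]
    [Nontrivial N] : ∃ x ∈ socle R N, x ≠ 0 := by
  obtain ⟨S, hS, -⟩ := (IsAtomic.eq_bot_or_exists_atom_le (⊤ : Submodule R N)).resolve_left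
    top_ne_bot
  have : IsSimpleModule R S := isSimpleModule_iff_isAtom.2 hS
  obtain ⟨x, hx, h0⟩ := S.exists_mem_ne_zero_of_ne_bot hS.1
  exact ⟨x, mem_socle.2 fun a ha => congrArg Subtype.val
    (IsSimpleModule.smul_eq_zero_of_mem_maximalIdeal ha (⟨x, hx⟩ : S)), h0⟩

/-- `E` behaves like an injective hull of the residue field for finite length modules killed
by `t`. -/
structure IsDualizingModulo (t : R) (E : Type u) [AddCommGroup E] [Module R E] : Prop where
  smul_eq_zero (e : E) : t • e = 0
  exists_extension (N : Type u) [AddCommGroup N] [Module R N] [IsArtinian R N] [IsNoetherian R N]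
    (hN : ∀ x : N, t • x = 0) (N' : Submodule R N) (f : N' →ₗ[R] E) :
    ∃ F : N →ₗ[R] E, ∀ x : N', F x = f x
  length_hom_of_isSimpleModule (S : Type u) [AddCommGroup S] [Module R S] [IsSimpleModule R S] :
    Module.length R (S →ₗ[R] E) = 1

theorem exists_extension_of_forall_maximalIdeal {t : R} (ht : t ∈ maximalIdeal R) {E : Type u}
    [AddCommGroup E] [Module R E]
    (hE : ∀ g : maximalIdeal R →ₗ[R] E, g ⟨t, ht⟩ = 0 → ∃ e, ∀ a, g a = (a : R) • e)
    (N : Type u) [AddCommGroup N] [Module R N] [IsArtinian R N] [IsNoetherian R N]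
    (hN : ∀ x : N, t • x = 0) (N' : Submodule R N) (f : N' →ₗ[R] E) :
    ∃ F : N →ₗ[R] E, ∀ x : N', F x = f x := by
  induction N' using WellFoundedGT.induction with
  | ind N' ih =>
  by_cases htop : N' = ⊤
  · subst htop
    exact ⟨f ∘ₗ (LinearEquiv.ofTop ⊤ rfl).symm.toLinearMap, fun x => rfl⟩
  have : Nontrivial (N ⧸ N') := Submodule.Quotient.nontrivial_iff.2 htop
  obtain ⟨x, hx, hx0⟩ := exists_ne_zero_mem_socle (R := R) (N ⧸ N')
  obtain ⟨n, rfl⟩ := Submodule.Quotient.mk_surjective _ x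
  rw [Ne, Submodule.Quotient.mk_eq_zero] at hx0
  have hm (a : maximalIdeal R) : (a : R) • n ∈ N' := by
    rw [← Submodule.Quotient.mk_eq_zero, Submodule.Quotient.mk_smul]
    exact mem_socle.1 hx a a.2
  let j : maximalIdeal R →ₗ[R] N' :=
    (LinearMap.toSpanSingleton R N n ∘ₗ (maximalIdeal R).subtype).codRestrict _ hm
  obtain ⟨e, he⟩ := hE (f ∘ₗ j) (by
    have : j ⟨t, ht⟩ = 0 := by
      ext
      exact hN n
    simp [this])
  let N'' := N' ⊔ Submodule.span R {n}
  let p : N' × R →ₗ[R] N'' := (N'.subtype.coprod (LinearMap.toSpanSingleton R N n)).codRestrict N''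
    fun y => Submodule.add_mem_sup y.1.2 (Submodule.smul_mem _ _
      (Submodule.mem_span_singleton_self n))
  have hp : Function.Surjective p := by
    rintro ⟨y, hy⟩
    obtain ⟨a, ha, b, hb, rfl⟩ := Submodule.mem_sup.1 hy
    obtain ⟨r, rfl⟩ := Submodule.mem_span_singleton.1 hb
    exact ⟨(⟨a, ha⟩, r), rfl⟩
  obtain ⟨F, hF⟩ := LinearMap.exists_factor_of_ker_le hp
    (g := f.coprod (LinearMap.toSpanSingleton R E e)) (by
      rintro ⟨a, r⟩ h
      have h' : (a : N) + r • n = 0 := congrArg Subtype.val h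
      have hr : r ∈ maximalIdeal R := by
        rw [mem_maximalIdeal]
        intro hu
        refine hx0 ((Submodule.smul_mem_iff_of_isUnit N' hu).1 ?_)
        rw [add_comm, add_eq_zero_iff_eq_neg] at h'
        rw [h']
        exact N'.neg_mem a.2
      have : a = - j ⟨r, hr⟩ := by
        ext
        exact eq_neg_of_add_eq_zero_left h'
      have h3 := he ⟨r, hr⟩
      simp only [LinearMap.comp_apply] at h3
      simp [this, h3])
  obtain ⟨G, hG⟩ := ih N'' (lt_of_le_of_ne le_sup_left fun h => hx0 (by
    rw [h]
    exact Submodule.mem_sup_right (Submodule.mem_span_singleton_self n))) F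
  refine ⟨G, fun x => ?_⟩
  have h1 : p (x, 0) = ⟨x, Submodule.mem_sup_left x.2⟩ := by
    ext
    change (x : N) + (0 : R) • n = x
    simp
  have h2 := hF (x, 0)
  rw [h1, ← hG] at h2
  simpa using h2

/-- The reduction of a canonical module modulo a nonzerodivisor is dualizing. -/
theorem isDualizingModulo_of_canonical {K : Type u} [AddCommGroup K] [Module R K]
    (hsoc : ∀ κ : K, (∀ a ∈ maximalIdeal R, a • κ = 0) → κ = 0)
    {t : R} (ht : t ∈ maximalIdeal R) (htK : ∀ κ : K, t • κ = 0 → κ = 0)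
    {E : Type u} [AddCommGroup E] [Module R E] [IsArtinian R E] [Nontrivial E]
    {π : K →ₗ[R] E} (hπ : Function.Surjective π) (hker : ∀ κ, π κ = 0 ↔ ∃ κ', κ = t • κ')
    (hlift : ∀ g : maximalIdeal R →ₗ[R] E, ∃ h : maximalIdeal R →ₗ[R] K, π ∘ₗ h = g)
    (L : (maximalIdeal R →ₗ[R] K) →ₗ[R] (R ⧸ maximalIdeal R))
    (hL : ∀ f, L f = 0 → ∃ κ : K, ∀ a, f a = (a : R) • κ) :
    IsDualizingModulo t E := by
  have tinj {a b : K} (h : t • a = t • b) : a = b := by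
    rw [← sub_eq_zero] at h ⊢
    exact htK _ (by rw [smul_sub, h])
  have hsoc' {κ κ' : K} (h : ∀ a ∈ maximalIdeal R, a • κ = a • κ') : κ = κ' := by
    rw [← sub_eq_zero]
    exact hsoc _ fun a ha => by rw [smul_sub, h a ha, sub_self]
  have hsocE (e : E) (he : e ∈ socle R E) : ∃ (κ : K) (f : maximalIdeal R →ₗ[R] K), π κ = e ∧
      ∀ a : maximalIdeal R, (a : R) • κ = t • f a := by
    obtain ⟨κ, rfl⟩ := hπ e
    have (a : maximalIdeal R) : ∃ κ', (a : R) • κ = t • κ' := by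
      rw [← hker, map_smul]
      exact mem_socle.1 he a a.2
    choose f hf using this
    exact ⟨κ,
      { toFun := f
        map_add' := fun a b => tinj (by simp [← hf, smul_add, add_smul])
        map_smul' := fun r a => tinj (by
          rw [RingHom.id_apply, smul_comm t r]
          simp [← hf, mul_smul]) }, rfl, hf⟩
  have hdep (e e' : E) (he : e ∈ socle R E) (h0 : e ≠ 0) (he' : e' ∈ socle R E) :
      ∃ r : R, r • e = e' := by
    obtain ⟨κ, f, rfl, hf⟩ := hsocE e he
    obtain ⟨κ', f', rfl, hf'⟩ := hsocE e' he'
    have hLf : L f ≠ 0 := by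
      intro h
      obtain ⟨k, hk⟩ := hL f h
      refine h0 ((hker κ).2 ⟨k, hsoc' fun a ha => ?_⟩)
      rw [hf ⟨a, ha⟩, hk, smul_comm]
    obtain ⟨r, hr⟩ : ∃ r : R, r • L f = L f' := by
      have : IsSimpleModule R (R ⧸ maximalIdeal R) :=
        isSimpleModule_iff_isCoatom.2 (maximalIdeal.isMaximal R).out
      exact IsSimpleModule.toSpanSingleton_surjective R hLf (L f')
    obtain ⟨k, hk⟩ := hL (f' - r • f) (by simp [hr])
    refine ⟨r, ?_⟩
    rw [← map_smul, eq_comm, ← sub_eq_zero, ← map_sub, hker]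
    refine ⟨k, hsoc' fun a ha => ?_⟩
    rw [smul_sub, hf' ⟨a, ha⟩, smul_comm a r, hf ⟨a, ha⟩, smul_comm a t, smul_comm r t, ← smul_sub]
    exact congrArg _ (hk ⟨a, ha⟩)
  refine ⟨fun e => ?_, exists_extension_of_forall_maximalIdeal ht ?_, fun S _ _ _ => ?_⟩
  · obtain ⟨κ, rfl⟩ := hπ e
    rw [← map_smul, hker]
    exact ⟨κ, rfl⟩
  · intro g hg
    obtain ⟨h, rfl⟩ := hlift g
    obtain ⟨κ, hκ⟩ := (hker _).1 hg
    refine ⟨π κ, fun a => ?_⟩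
    rw [← map_smul]
    refine congrArg π (tinj ?_)
    rw [smul_comm, ← hκ, ← map_smul, ← map_smul]
    congr 1
    ext
    simp [mul_comm]
  · rw [Module.length_eq_one_iff]
    have := IsSimpleModule.nontrivial R S
    obtain ⟨s, hs⟩ := exists_ne (0 : S)
    have hsurj := IsSimpleModule.toSpanSingleton_surjective R hs
    have hmem (φ : S →ₗ[R] E) : φ s ∈ socle R E := mem_socle.2 fun a ha => by
      rw [← map_smul, IsSimpleModule.smul_eq_zero_of_mem_maximalIdeal ha, map_zero]
    have hext {φ ψ : S →ₗ[R] E} (h : φ s = ψ s) : φ = ψ := by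
      ext x
      obtain ⟨r, rfl⟩ := hsurj x
      simp [h]
    rw [isSimpleModule_iff_toSpanSingleton_surjective]
    constructor
    · obtain ⟨e, he, he0⟩ := exists_ne_zero_mem_socle (R := R) E
      obtain ⟨F, hF⟩ := LinearMap.exists_factor_of_ker_le hsurj
        (g := LinearMap.toSpanSingleton R E e) (fun r hr => by
          refine mem_socle.1 he r ((mem_maximalIdeal r).2 fun hu => hs ?_)
          exact (hu.smul_eq_zero).1 hr)
      refine ⟨⟨F, 0, fun h => he0 ?_⟩⟩
      have := hF 1
      simp only [LinearMap.toSpanSingleton_apply, one_smul] at this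
      rw [← this, h, LinearMap.zero_apply]
    · intro φ hφ ψ
      obtain ⟨r, hr⟩ := hdep (φ s) (ψ s) (hmem φ) (fun h => hφ (hext h)) (hmem ψ)
      exact ⟨r, hext hr⟩

end Duality

section DualizingModulo

variable {R : Type u} [CommRing R]

theorem LinearMap.bijective_of_injective_of_length_eq {R A B : Type*} [Ring R] [AddCommGroup A]
    [AddCommGroup B] [Module R A] [Module R B] {f : A →ₗ[R] B} (hf : Function.Injective f)
    (hA : Module.length R A ≠ ⊤) (h : Module.length R A = Module.length R B) :
    Function.Bijective f := by
  refine ⟨hf, LinearMap.range_eq_top.1 ?_⟩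
  have h1 := Module.length_eq_add_of_exact f f.range.mkQ hf (Submodule.mkQ_surjective _)
    (LinearMap.exact_map_mkQ_range f)
  rw [← h] at h1
  have h2 : Module.length R (B ⧸ f.range) = 0 :=
    ENat.add_right_injective_of_ne_top hA (h1.symm.trans (add_zero _).symm)
  rw [Module.length_eq_zero_iff] at h2
  exact Submodule.Quotient.subsingleton_iff.1 h2

namespace IsDualizingModulo

variable {t : R} {E : Type u} [AddCommGroup E] [Module R E]

theorem length_hom (hE : IsDualizingModulo t E) (N : Type u) [AddCommGroup N] [Module R N]
    (hfin : IsFiniteLength R N) (hN : ∀ x : N, t • x = 0) :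
    Module.length R (N →ₗ[R] E) = Module.length R N := by
  induction hfin with
  | of_subsingleton =>
    rw [Module.length_eq_zero, Module.length_eq_zero]
  | @of_simple_quotient N _ _ N' _ h ih =>
    have hfin := IsFiniteLength.of_simple_quotient h
    obtain ⟨_, _⟩ := isFiniteLength_iff_isNoetherian_isArtinian.1 hfin
    rw [Module.length_eq_add_of_exact N'.subtype N'.mkQ N'.subtype_injective
      N'.mkQ_surjective (LinearMap.exact_subtype_mkQ N'),
      ← ih fun x => Subtype.ext (hN x), Module.length_eq_one R (N ⧸ N'),
      ← hE.length_hom_of_isSimpleModule (N ⧸ N'), add_comm]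
    refine Module.length_eq_add_of_exact (LinearMap.lcomp R E N'.mkQ)
      (LinearMap.lcomp R E N'.subtype) (fun f g hfg => ?_) (fun f => ?_) (fun f => ?_)
    · ext x
      exact congr($hfg x)
    · obtain ⟨F, hF⟩ := hE.exists_extension N hN N' f
      exact ⟨F, LinearMap.ext hF⟩
    · constructor
      · intro h
        refine ⟨N'.liftQ f fun x hx => congr($h ⟨x, hx⟩), ?_⟩
        ext x
        rfl
      · rintro ⟨g, rfl⟩
        ext x
        simp [(Submodule.Quotient.mk_eq_zero N').2 x.2]

theorem exists_apply_ne_zero (hE : IsDualizingModulo t E) {N : Type u} [AddCommGroup N]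
    [Module R N] [IsNoetherian R N] [IsArtinian R N] (hN : ∀ x : N, t • x = 0) {z : N}
    (hz : z ≠ 0) : ∃ f : N →ₗ[R] E, f z ≠ 0 := by
  have hfin : IsFiniteLength R (Submodule.span R {z}) :=
    isFiniteLength_iff_isNoetherian_isArtinian.2 ⟨inferInstance, inferInstance⟩
  have h1 := hE.length_hom _ hfin fun x => Subtype.ext (hN x)
  have h2 : Nontrivial (Submodule.span R {z}) := by
    rw [Submodule.nontrivial_iff_ne_bot, Ne, Submodule.span_singleton_eq_bot]
    exact hz
  rw [← Module.length_pos_iff (R := R), ← h1, Module.length_pos_iff] at h2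
  obtain ⟨f, hf⟩ := exists_ne (0 : Submodule.span R {z} →ₗ[R] E)
  obtain ⟨F, hF⟩ := hE.exists_extension N hN _ f
  refine ⟨F, fun h => hf ?_⟩
  ext ⟨x, hx⟩
  obtain ⟨r, rfl⟩ := Submodule.mem_span_singleton.1 hx
  rw [← hF, map_smul, h, smul_zero, LinearMap.zero_apply]

theorem applyₗ_bijective (hE : IsDualizingModulo t E) {N : Type u} [AddCommGroup N]
    [Module R N] [IsNoetherian R N] [IsArtinian R N] (hN : ∀ x : N, t • x = 0) :
    Function.Bijective (LinearMap.applyₗ : N →ₗ[R] (N →ₗ[R] E) →ₗ[R] E) := by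
  have hfin : IsFiniteLength R N :=
    isFiniteLength_iff_isNoetherian_isArtinian.2 ⟨inferInstance, inferInstance⟩
  have h1 := hE.length_hom _ hfin hN
  have hfin' : IsFiniteLength R (N →ₗ[R] E) := by
    rw [← Module.length_ne_top_iff, h1, Module.length_ne_top_iff]
    exact hfin
  refine LinearMap.bijective_of_injective_of_length_eq ?_ (Module.length_ne_top_iff.2 hfin) ?_
  · rw [injective_iff_map_eq_zero]
    intro z hz
    by_contra h0
    obtain ⟨f, hf⟩ := hE.exists_apply_ne_zero hN h0
    exact hf congr($hz f)
  · rw [hE.length_hom _ hfin' fun f => LinearMap.ext fun x => by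
      rw [LinearMap.smul_apply, hE.smul_eq_zero, LinearMap.zero_apply], h1]

variable [IsLocalRing R]

theorem length_top_hom (hE : IsDualizingModulo t E) {N : Type u}
    [AddCommGroup N] [Module R N] [IsNoetherian R N] [IsArtinian R N] (hN : ∀ x : N, t • x = 0) :
    Module.length R ((N →ₗ[R] E) ⧸ maximalIdeal R • (⊤ : Submodule R (N →ₗ[R] E))) =
      Module.length R (socle R N) := by
  have hfin : IsFiniteLength R N :=
    isFiniteLength_iff_isNoetherian_isArtinian.2 ⟨inferInstance, inferInstance⟩
  have h1 := hE.length_hom _ hfin hN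
  have hfin' : IsFiniteLength R (N →ₗ[R] E) := by
    rw [← Module.length_ne_top_iff, h1, Module.length_ne_top_iff]
    exact hfin
  obtain ⟨hbi, hbs⟩ := hE.applyₗ_bijective hN
  have hX (f : N →ₗ[R] E) : t • f = 0 := LinearMap.ext fun x => by
    rw [LinearMap.smul_apply, hE.smul_eq_zero, LinearMap.zero_apply]
  set W : Submodule R (N →ₗ[R] E) := maximalIdeal R • (⊤ : Submodule R (N →ₗ[R] E))
  rw [← hE.length_hom _ (hfin'.of_surjective W.mkQ_surjective) (by
    intro x
    obtain ⟨x, rfl⟩ := W.mkQ_surjective x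
    rw [← map_smul, hX, map_zero])]
  let g : socle R N →ₗ[R] ((N →ₗ[R] E) ⧸ W) →ₗ[R] E :=
    { toFun := fun n => W.liftQ (LinearMap.applyₗ (n : N)) (by
        refine Submodule.smul_le.2 fun a ha f _ => ?_
        rw [LinearMap.mem_ker, map_smul, LinearMap.applyₗ_apply_apply, ← map_smul,
          mem_socle.1 n.2 a ha, map_zero])
      map_add' := fun n n' => by
        ext f
        simp
      map_smul' := fun r n => by
        ext f
        simp }
  refine ((LinearEquiv.ofBijective g ⟨?_, fun φ => ?_⟩).length_eq).symm
  · rw [injective_iff_map_eq_zero]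
    intro n hn
    ext
    rw [← hbi.eq_iff, ZeroMemClass.coe_zero, map_zero]
    ext f
    exact congr($hn (W.mkQ f))
  · obtain ⟨n, hn⟩ := hbs (φ ∘ₗ W.mkQ)
    refine ⟨⟨n, mem_socle.2 fun a ha => hbi ?_⟩, ?_⟩
    · rw [map_smul, hn, map_zero]
      ext f
      rw [LinearMap.smul_apply, LinearMap.comp_apply, ← map_smul, ← map_smul]
      have : W.mkQ (a • f) = 0 := by
        rw [Submodule.mkQ_apply, Submodule.Quotient.mk_eq_zero]
        exact Submodule.smul_mem_smul ha trivial
      rw [this, map_zero, LinearMap.zero_apply]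
    · ext f
      exact congr($hn f)

end IsDualizingModulo

end DualizingModulo

section Lifting

theorem minGen_eq_spanFinrank {R M : Type*} [Semiring R] [AddCommMonoid M] [Module R M]
    {p : Submodule R M} (hp : p.FG) : minGen R p = p.spanFinrank := by
  obtain ⟨s, hs, hsp⟩ := hp.exists_span_finset_card_eq_spanFinrank
  refine le_antisymm (Nat.sInf_le ⟨s, hs, hsp⟩) (le_csInf ⟨_, s, rfl, hsp⟩ ?_)
  rintro n ⟨s, rfl, rfl⟩
  simpa using Submodule.spanFinrank_span_le_ncard_of_finite (R := R) s.finite_toSet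

variable {R : Type u} [CommRing R] [IsLocalRing R]

theorem minGen_eq_length {M : Type*} [AddCommGroup M] [Module R M] {p : Submodule R M}
    (hp : p.FG) :
    (minGen R p : ℕ∞) = Module.length R (p ⧸ maximalIdeal R • (⊤ : Submodule R p)) := by
  have : Module.Finite R p := Module.Finite.iff_fg.2 hp
  rw [minGen_eq_spanFinrank hp, IsLocalRing.spanFinrank_eq_finrank_quotient p hp]
  have : Module.Finite (R ⧸ maximalIdeal R) (p ⧸ maximalIdeal R • (⊤ : Submodule R p)) :=
    Module.Finite.of_restrictScalars_finite R _ _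
  let := Ideal.Quotient.field (maximalIdeal R)
  have h := Module.length_eq_finrank (R ⧸ maximalIdeal R) (p ⧸ maximalIdeal R • (⊤ : Submodule R p))
  rw [← h]
  exact (Module.length_eq_of_surjective (S := R) (R := R ⧸ maximalIdeal R)
    (M := p ⧸ maximalIdeal R • (⊤ : Submodule R p)) Ideal.Quotient.mk_surjective).symm

theorem minGen_top_eq_length {M : Type*} [AddCommGroup M] [Module R M] [Module.Finite R M] :
    (minGen R (⊤ : Submodule R M) : ℕ∞) =
      Module.length R (M ⧸ maximalIdeal R • (⊤ : Submodule R M)) := by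
  rw [minGen_eq_length Module.Finite.fg_top]
  refine (Submodule.Quotient.equiv _ _ Submodule.topEquiv ?_).length_eq
  simp [Submodule.map_smul'']

theorem length_le_length_top_of_surjective {M V : Type*} [AddCommGroup M] [Module R M]
    [AddCommGroup V] [Module R V] {f : M →ₗ[R] V} (hf : Function.Surjective f)
    (hV : ∀ a ∈ maximalIdeal R, ∀ v : V, a • v = 0) :
    Module.length R V ≤ Module.length R (M ⧸ maximalIdeal R • (⊤ : Submodule R M)) := by
  obtain ⟨F, hF⟩ := LinearMap.exists_factor_of_ker_le (g := f)
    (Submodule.mkQ_surjective (maximalIdeal R • (⊤ : Submodule R M))) (by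
      intro x hx
      rw [Submodule.mkQ_apply, Submodule.Quotient.mk_eq_zero] at hx
      refine (Submodule.smul_le (P := LinearMap.ker f)).2 (fun a ha y _ => ?_) hx
      rw [LinearMap.mem_ker, map_smul, hV a ha])
  refine Module.length_le_of_surjective F fun v => ?_
  obtain ⟨x, rfl⟩ := hf v
  exact ⟨_, hF x⟩

theorem smul_quotient_maximalIdeal {M : Type*} [AddCommGroup M] [Module R M] (a : R)
    (ha : a ∈ maximalIdeal R) (v : M ⧸ maximalIdeal R • (⊤ : Submodule R M)) : a • v = 0 := by
  obtain ⟨x, rfl⟩ := Submodule.mkQ_surjective _ v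
  rw [← map_smul, Submodule.mkQ_apply, Submodule.Quotient.mk_eq_zero]
  exact Submodule.smul_mem_smul ha trivial

theorem isArtinian_of_smul_eq_zero {R : Type*} [CommRing R] {t : R}
    (ht : IsFiniteLength R (R ⧸ Ideal.span {t})) (N : Type*) [AddCommGroup N] [Module R N]
    [Module.Finite R N] (hN : ∀ x : N, t • x = 0) : IsArtinian R N := by
  have : IsArtinian R (R ⧸ Ideal.span {t}) := (isFiniteLength_iff_isNoetherian_isArtinian.1 ht).2
  obtain ⟨n, f, hf⟩ := Module.Finite.exists_fin' R N
  let W : Submodule R (Fin n → R) := Submodule.pi Set.univ fun _ => Ideal.span {t}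
  have : IsArtinian R ((Fin n → R) ⧸ W) :=
    isArtinian_of_linearEquiv (Submodule.quotientPi fun _ : Fin n => Ideal.span {t}).symm
  obtain ⟨F, hF⟩ := LinearMap.exists_factor_of_ker_le (f := W.mkQ) (g := f) W.mkQ_surjective (by
    intro x hx
    rw [Submodule.mkQ_apply, Submodule.Quotient.mk_eq_zero] at hx
    choose y hy using fun i => Ideal.mem_span_singleton'.1 (hx i trivial)
    have : x = t • y := by
      ext i
      rw [← hy, Pi.smul_apply, smul_eq_mul, mul_comm]
    rw [this, map_smul, hN])
  refine isArtinian_of_surjective _ F fun x => ?_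
  obtain ⟨y, rfl⟩ := hf x
  exact ⟨W.mkQ y, hF y⟩

/-- Maps to the reduction of a canonical module lift to the canonical module. -/
theorem exists_lift_of_isDualizingModulo [IsNoetherianRing R] {t : R} (ht : t ∈ maximalIdeal R)
    (htR : IsFiniteLength R (R ⧸ Ideal.span {t}))
    {K E : Type u} [AddCommGroup K] [Module R K] [Module.Finite R K] [AddCommGroup E] [Module R E]
    (hE : IsDualizingModulo t E) {π : K →ₗ[R] E} (hπ : Function.Surjective π)
    (hker : ∀ κ, π κ = 0 ↔ ∃ κ', κ = t • κ') (htK : ∀ κ : K, t • κ = 0 → κ = 0)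
    {M : Type u} [AddCommGroup M] [Module R M] [Module.Finite R M]
    (htM : ∀ x : M, t • x = 0 → x = 0) (g : M →ₗ[R] E) : ∃ h : M →ₗ[R] K, π ∘ₗ h = g := by
  have tinj {a b : K} (h : t • a = t • b) : a = b := by
    rw [← sub_eq_zero] at h ⊢
    exact htK _ (by rw [smul_sub, h])
  obtain ⟨n, p, hp⟩ := Module.Finite.exists_fin' R M
  have hdiv {α : Type u} [AddCommGroup α] [Module R α] (φ : α →ₗ[R] K) (hφ : π ∘ₗ φ = 0) :
      ∃ χ : α →ₗ[R] K, φ = t • χ := by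
    choose χ hχ using fun x => (hker (φ x)).1 congr($hφ x)
    exact ⟨{ toFun := χ
             map_add' := fun a b => tinj (by simp [← hχ])
             map_smul' := fun r a => tinj (by
              rw [RingHom.id_apply, smul_comm t r]
              simp [← hχ]) }, LinearMap.ext hχ⟩
  have hext : LinearMap.range (LinearMap.lcomp R K (LinearMap.ker p).subtype) = ⊤ := by
    rw [eq_top_iff]
    refine Submodule.le_of_le_smul_of_le_jacobson_bot (I := Ideal.span {t})
      (Module.Finite.fg_top) ?_ ?_
    · rw [IsLocalRing.jacobson_eq_maximalIdeal _ bot_ne_top, Ideal.span_singleton_le_iff_mem]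
      exact ht
    · intro φ _
      let W : Submodule R (Fin n → R) := Ideal.span {t} • ⊤
      have hW (x) : t • x ∈ W :=
        Submodule.smul_mem_smul (Ideal.mem_span_singleton_self t) trivial
      have hWt {x} (hx : x ∈ W) : ∃ y, x = t • y := by
        rw [show W = _ from Submodule.ideal_span_singleton_smul t ⊤] at hx
        obtain ⟨y, -, h⟩ := hx
        exact ⟨y, h.symm⟩
      have hN (x : (Fin n → R) ⧸ W) : t • x = 0 := by
        obtain ⟨x, rfl⟩ := W.mkQ_surjective x
        rw [← map_smul, Submodule.mkQ_apply, Submodule.Quotient.mk_eq_zero]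
        exact hW x
      have := isArtinian_of_smul_eq_zero htR _ hN
      let q : LinearMap.ker p →ₗ[R] (LinearMap.ker p).map W.mkQ := W.mkQ.submoduleMap _
      obtain ⟨f, hf⟩ := LinearMap.exists_factor_of_ker_le (f := q) (g := π ∘ₗ φ)
        (W.mkQ.submoduleMap_surjective _) (by
          intro x hx
          have hx' : W.mkQ (x : Fin n → R) = 0 := congrArg Subtype.val hx
          rw [Submodule.mkQ_apply, Submodule.Quotient.mk_eq_zero] at hx'
          obtain ⟨y, hy⟩ := hWt hx'
          have hy' : p y = 0 := htM _ (by rw [← map_smul, ← hy]; exact x.2)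
          have : x = t • (⟨y, hy'⟩ : LinearMap.ker p) := Subtype.ext hy
          rw [this, map_smul]
          exact hE.smul_eq_zero _)
      obtain ⟨F, hF⟩ := hE.exists_extension _ hN _ f
      obtain ⟨ψ, hψ⟩ := Module.projective_lifting_property π (F ∘ₗ W.mkQ) hπ
      obtain ⟨χ, hχ⟩ := hdiv (φ - ψ ∘ₗ (LinearMap.ker p).subtype) (by
        ext x
        have h1 : π (ψ x) = F (W.mkQ x) := congr($hψ x)
        have h2 : F (W.mkQ x) = f (q x) := hF (q x)
        simp only [LinearMap.comp_apply, LinearMap.sub_apply, map_sub, Submodule.subtype_apply,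
          h1, h2,
          hf, sub_self, LinearMap.zero_apply])
      rw [← sub_add_cancel φ (ψ ∘ₗ (LinearMap.ker p).subtype), hχ, add_comm]
      exact Submodule.add_mem_sup ⟨ψ, rfl⟩
        (Submodule.smul_mem_smul (Ideal.mem_span_singleton_self t) trivial)
  obtain ⟨h, hh⟩ := Module.projective_lifting_property π (g ∘ₗ p) hπ
  have hh' (x) : π (h x) = g (p x) := congr($hh x)
  obtain ⟨χ, hχ⟩ := hdiv (h ∘ₗ (LinearMap.ker p).subtype) (by
    ext x
    simp [hh'])
  obtain ⟨ψ, hψ⟩ := LinearMap.range_eq_top.1 hext χ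
  obtain ⟨F, hF⟩ := LinearMap.exists_factor_of_ker_le hp (g := h - t • ψ) (by
    intro x hx
    have h1 : h x = t • χ ⟨x, hx⟩ := congr($hχ ⟨x, hx⟩)
    have h2 : ψ x = χ ⟨x, hx⟩ := congr($hψ ⟨x, hx⟩)
    simp [h1, h2])
  refine ⟨F, ?_⟩
  ext x
  obtain ⟨x, rfl⟩ := hp x
  have h0 : π (t • ψ x) = 0 := (hker _).2 ⟨_, rfl⟩
  rw [LinearMap.comp_apply, hF, LinearMap.sub_apply, map_sub, LinearMap.smul_apply, h0, hh',
    sub_zero]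

end Lifting

section Canonical

theorem exists_span_singleton_eq_of_minGen_le_one {R M : Type*} [Semiring R] [AddCommMonoid M]
    [Module R M] {p : Submodule R M} (hp : p.FG) (h : minGen R p ≤ 1) :
    ∃ x, Submodule.span R {x} = p := by
  obtain ⟨s₀, hs₀⟩ := hp
  obtain ⟨s, hs, rfl⟩ := Nat.sInf_mem
    (s := {n | ∃ s : Finset M, s.card = n ∧ Submodule.span R (s : Set M) = p}) ⟨_, s₀, rfl, hs₀⟩
  change _ = minGen R _ at hs
  rw [← hs, Finset.card_le_one_iff_subset_singleton] at h
  obtain ⟨x, hx⟩ := h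
  obtain rfl | rfl := Finset.subset_singleton_iff.1 hx
  · exact ⟨0, by simp⟩
  · exact ⟨x, by simp⟩

theorem mem_span_singleton_smul_top {R M : Type*} [CommRing R] [AddCommGroup M] [Module R M]
    {t : R} {x : M} : x ∈ Ideal.span {t} • (⊤ : Submodule R M) ↔ ∃ y, x = t • y := by
  rw [Submodule.ideal_span_singleton_smul]
  constructor
  · rintro ⟨y, -, h⟩
    exact ⟨y, h.symm⟩
  · rintro ⟨y, rfl⟩
    exact ⟨y, trivial, rfl⟩

theorem smul_quotient_span_singleton {R M : Type*} [CommRing R] [AddCommGroup M] [Module R M]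
    {t : R} (x : M ⧸ Ideal.span {t} • (⊤ : Submodule R M)) : t • x = 0 := by
  obtain ⟨x, rfl⟩ := Submodule.mkQ_surjective _ x
  rw [← map_smul, Submodule.mkQ_apply, Submodule.Quotient.mk_eq_zero, mem_span_singleton_smul_top]
  exact ⟨x, rfl⟩

theorem Ideal.smul_quotient_span_singleton {R : Type*} [CommRing R] {t : R}
    (x : R ⧸ Ideal.span {t}) : t • x = 0 := by
  obtain ⟨x, rfl⟩ := Ideal.Quotient.mk_surjective x
  rw [← Ideal.Quotient.mkₐ_eq_mk R, ← map_smul, Ideal.Quotient.mkₐ_eq_mk,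
    Ideal.Quotient.eq_zero_iff_mem]
  exact Ideal.mul_mem_right _ _ (Ideal.mem_span_singleton_self t)

theorem bijective_applyₗ_mk_one {R E : Type*} [CommRing R] [AddCommGroup E] [Module R E] {t : R}
    (hE : ∀ e : E, t • e = 0) : Function.Bijective
      (LinearMap.applyₗ (Ideal.Quotient.mk (Ideal.span {t}) 1) :
        ((R ⧸ Ideal.span {t}) →ₗ[R] E) →ₗ[R] E) := by
  refine ⟨fun f g h => ?_, fun e => ?_⟩
  · ext
    exact h
  · obtain ⟨F, hF⟩ := LinearMap.exists_factor_of_ker_le (Submodule.mkQ_surjective (Ideal.span {t}))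
      (g := LinearMap.toSpanSingleton R E e) (by
        intro x hx
        rw [Submodule.mkQ_apply, Submodule.Quotient.mk_eq_zero] at hx
        obtain ⟨y, rfl⟩ := Ideal.mem_span_singleton'.1 hx
        rw [LinearMap.toSpanSingleton_apply, mul_smul, hE, smul_zero])
    exact ⟨F, (hF 1).trans (one_smul R e)⟩

variable {R : Type u} [CommRing R] [IsLocalRing R] [IsNoetherianRing R]
  {K : Type u} [AddCommGroup K] [Module R K] {t : R}

theorem IsCanonicalModuleAt.isDualizingModulo (hK : IsCanonicalModuleAt R (maximalIdeal R) K)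
    (ht : t ∈ maximalIdeal R) (htR : IsFiniteLength R (R ⧸ Ideal.span {t})) :
    (∀ κ : K, t • κ = 0 → κ = 0) ∧
      IsDualizingModulo t (K ⧸ Ideal.span {t} • (⊤ : Submodule R K)) := by
  obtain ⟨hsoc, hlift, ⟨L, hL⟩, _⟩ := hK.elementary
  have : Module.Finite R K := hK.1
  have htK : ∀ κ : K, t • κ = 0 → κ = 0 := by
    intro κ hκ
    by_contra h0
    let Z : Submodule R K := LinearMap.ker (LinearMap.lsmul R K t)
    have : IsArtinian R Z := isArtinian_of_smul_eq_zero htR Z fun x => Subtype.ext x.2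
    have : Nontrivial Z := ⟨⟨⟨κ, hκ⟩, 0, fun h => h0 (congrArg Subtype.val h)⟩⟩
    obtain ⟨x, hx, hx0⟩ := exists_ne_zero_mem_socle (R := R) Z
    exact hx0 (Subtype.ext (hsoc x fun a ha => congrArg Subtype.val (mem_socle.1 hx a ha)))
  refine ⟨htK, ?_⟩
  have hker (κ : K) : (Ideal.span {t} • (⊤ : Submodule R K)).mkQ κ = 0 ↔ ∃ κ', κ = t • κ' := by
    rw [Submodule.mkQ_apply, Submodule.Quotient.mk_eq_zero, mem_span_singleton_smul_top]
  have := isArtinian_of_smul_eq_zero htR (K ⧸ Ideal.span {t} • (⊤ : Submodule R K))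
    smul_quotient_span_singleton
  have : Nontrivial (K ⧸ Ideal.span {t} • (⊤ : Submodule R K)) := by
    rw [Submodule.Quotient.nontrivial_iff]
    intro h
    refine top_ne_bot (α := Submodule R K)
      (Submodule.eq_bot_of_le_smul_of_le_jacobson_bot _ _ Module.Finite.fg_top h.ge ?_)
    rw [IsLocalRing.jacobson_eq_maximalIdeal _ bot_ne_top, Ideal.span_singleton_le_iff_mem]
    exact ht
  exact isDualizingModulo_of_canonical hsoc ht htK (Submodule.mkQ_surjective _) hker
    (hlift t htK _ _ (Submodule.mkQ_surjective _) hker) L hL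

theorem IsCanonicalModuleAt.minGen_le (hK : IsCanonicalModuleAt R (maximalIdeal R) K)
    (ht : t ∈ maximalIdeal R) (htR : IsFiniteLength R (R ⧸ Ideal.span {t})) :
    (minGen R (⊤ : Submodule R K) : ℕ∞) ≤ Module.length R (socle R (R ⧸ Ideal.span {t})) := by
  have : Module.Finite R K := hK.1
  obtain ⟨htK, hE⟩ := hK.isDualizingModulo ht htR
  obtain ⟨_, _⟩ := isFiniteLength_iff_isNoetherian_isArtinian.1 htR
  rw [minGen_top_eq_length, ← hE.length_top_hom Ideal.smul_quotient_span_singleton]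
  obtain ⟨ρ, hρ⟩ := LinearMap.exists_factor_of_ker_le
    (Submodule.mkQ_surjective (Ideal.span {t} • (⊤ : Submodule R K)))
    (g := (maximalIdeal R • (⊤ : Submodule R K)).mkQ) (by
      intro x hx
      rw [Submodule.mkQ_apply, Submodule.Quotient.mk_eq_zero] at hx ⊢
      exact Submodule.smul_mono_left ((Ideal.span_singleton_le_iff_mem _).2 ht) hx)
  refine length_le_length_top_of_surjective (f := ρ ∘ₗ LinearMap.applyₗ (Ideal.Quotient.mk _ 1))
    (Function.Surjective.comp (g := ρ) (fun v => ?_)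
      (bijective_applyₗ_mk_one smul_quotient_span_singleton).2) smul_quotient_maximalIdeal
  obtain ⟨κ, rfl⟩ := Submodule.mkQ_surjective _ v
  exact ⟨_, hρ κ⟩

variable {M : Type u} [AddCommGroup M] [Module R M] [Module.Finite R M]

theorem IsCanonicalModuleAt.exists_lift (hK : IsCanonicalModuleAt R (maximalIdeal R) K)
    (ht : t ∈ maximalIdeal R) (htR : IsFiniteLength R (R ⧸ Ideal.span {t}))
    (htM : ∀ x : M, t • x = 0 → x = 0)
    (g : (M ⧸ Ideal.span {t} • (⊤ : Submodule R M)) →ₗ[R]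
      (K ⧸ Ideal.span {t} • (⊤ : Submodule R K))) :
    ∃ h : M →ₗ[R] K, ∀ x, Submodule.Quotient.mk (h x) = g (Submodule.Quotient.mk x) := by
  have : Module.Finite R K := hK.1
  obtain ⟨htK, hE⟩ := hK.isDualizingModulo ht htR
  obtain ⟨h, hh⟩ := exists_lift_of_isDualizingModulo ht htR hE (Submodule.mkQ_surjective _)
    (fun κ => by
      rw [Submodule.mkQ_apply, Submodule.Quotient.mk_eq_zero, mem_span_singleton_smul_top])
    htK htM (g ∘ₗ Submodule.mkQ _)
  exact ⟨h, fun x => congr($hh x)⟩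

theorem IsCanonicalModuleAt.length_socle_le_minGen
    (hK : IsCanonicalModuleAt R (maximalIdeal R) K)
    (ht : t ∈ maximalIdeal R) (htR : IsFiniteLength R (R ⧸ Ideal.span {t}))
    (htM : ∀ x : M, t • x = 0 → x = 0) :
    Module.length R (socle R (M ⧸ Ideal.span {t} • (⊤ : Submodule R M))) ≤
      minGen R (⊤ : Submodule R (M →ₗ[R] K)) := by
  have : Module.Finite R K := hK.1
  obtain ⟨htK, hE⟩ := hK.isDualizingModulo ht htR
  have := isArtinian_of_smul_eq_zero htR (M ⧸ Ideal.span {t} • (⊤ : Submodule R M))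
    smul_quotient_span_singleton
  rw [minGen_top_eq_length, ← hE.length_top_hom smul_quotient_span_singleton]
  let f : (M →ₗ[R] K) →ₗ[R] (M ⧸ Ideal.span {t} • (⊤ : Submodule R M)) →ₗ[R]
      (K ⧸ Ideal.span {t} • (⊤ : Submodule R K)) :=
    { toFun := fun φ => Submodule.mapQ _ _ φ (by
        intro x hx
        rw [Submodule.mem_comap]
        obtain ⟨y, rfl⟩ := mem_span_singleton_smul_top.1 hx
        exact mem_span_singleton_smul_top.2 ⟨φ y, map_smul _ _ _⟩)
      map_add' := fun φ ψ => by
        ext x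
        rfl
      map_smul' := fun r φ => by
        ext x
        rfl }
  refine length_le_length_top_of_surjective (f := Submodule.mkQ _ ∘ₗ f)
    ((Submodule.mkQ_surjective _).comp fun g => ?_) smul_quotient_maximalIdeal
  obtain ⟨h, hh⟩ := hK.exists_lift ht htR htM g
  refine ⟨h, ?_⟩
  ext x
  exact hh x

theorem IsCanonicalModuleAt.nonempty_linearEquiv
    (hK : IsCanonicalModuleAt R (maximalIdeal R) K)
    (ht : t ∈ maximalIdeal R) (htR : IsFiniteLength R (R ⧸ Ideal.span {t}))
    (htM : ∀ x : M, t • x = 0 → x = 0)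
    (hlen : Module.length R (M ⧸ Ideal.span {t} • (⊤ : Submodule R M)) =
      Module.length R (R ⧸ Ideal.span {t}))
    (hs : minGen R (⊤ : Submodule R (M →ₗ[R] K)) ≤ 1) : Nonempty (M ≃ₗ[R] K) := by
  have : Module.Finite R K := hK.1
  obtain ⟨htK, hE⟩ := hK.isDualizingModulo ht htR
  have hjac : Ideal.span {t} ≤ Ideal.jacobson ⊥ := by
    rw [IsLocalRing.jacobson_eq_maximalIdeal _ bot_ne_top, Ideal.span_singleton_le_iff_mem]
    exact ht
  have := isArtinian_of_smul_eq_zero htR (M ⧸ Ideal.span {t} • (⊤ : Submodule R M))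
    smul_quotient_span_singleton
  obtain ⟨φ, hφ⟩ := exists_span_singleton_eq_of_minGen_le_one
    (p := (⊤ : Submodule R (M →ₗ[R] K))) Module.Finite.fg_top hs
  let f : (M ⧸ Ideal.span {t} • (⊤ : Submodule R M)) →ₗ[R]
      (K ⧸ Ideal.span {t} • (⊤ : Submodule R K)) := Submodule.mapQ _ _ φ (by
    intro x hx
    rw [Submodule.mem_comap]
    obtain ⟨y, rfl⟩ := mem_span_singleton_smul_top.1 hx
    exact mem_span_singleton_smul_top.2 ⟨φ y, map_smul _ _ _⟩)
  have hf : Function.Injective f := by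
    rw [injective_iff_map_eq_zero]
    intro z hz
    by_contra h0
    obtain ⟨g, hg⟩ := hE.exists_apply_ne_zero smul_quotient_span_singleton h0
    obtain ⟨h, hh⟩ := hK.exists_lift ht htR htM g
    obtain ⟨r, rfl⟩ := Submodule.mem_span_singleton.1 (hφ ▸ Submodule.mem_top : h ∈ _)
    obtain ⟨z, rfl⟩ := Submodule.mkQ_surjective _ z
    refine hg ((hh z).symm.trans ?_)
    rw [LinearMap.smul_apply, Submodule.Quotient.mk_smul]
    exact (congrArg (r • ·) hz).trans (smul_zero r)
  have hlenE : Module.length R (K ⧸ Ideal.span {t} • (⊤ : Submodule R K)) =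
      Module.length R (R ⧸ Ideal.span {t}) := by
    rw [← hE.length_hom _ htR Ideal.smul_quotient_span_singleton]
    exact (LinearEquiv.ofBijective _
      (bijective_applyₗ_mk_one smul_quotient_span_singleton)).symm.length_eq
  have hfb := LinearMap.bijective_of_injective_of_length_eq hf Module.length_ne_top
    (hlen.trans hlenE.symm)
  have hsurj : LinearMap.range φ = ⊤ := by
    rw [eq_top_iff]
    refine Submodule.le_of_le_smul_of_le_jacobson_bot Module.Finite.fg_top hjac fun κ _ => ?_
    obtain ⟨z, hz⟩ := hfb.2 (Submodule.Quotient.mk κ)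
    obtain ⟨z, rfl⟩ := Submodule.mkQ_surjective _ z
    have h1 := (Submodule.Quotient.eq _).1 hz.symm
    rw [← sub_add_cancel κ (φ z), add_comm]
    exact Submodule.add_mem_sup ⟨z, rfl⟩ h1
  have hinj : LinearMap.ker φ = ⊥ := by
    refine Submodule.eq_bot_of_le_smul_of_le_jacobson_bot (Ideal.span {t}) _
      (IsNoetherian.noetherian _) (fun x hx => ?_) hjac
    have h1 : f (Submodule.Quotient.mk x) = 0 := by
      change Submodule.Quotient.mk (φ x) = _
      rw [LinearMap.mem_ker.1 hx, Submodule.Quotient.mk_zero]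
    have h2 := (injective_iff_map_eq_zero f).1 hf _ h1
    rw [Submodule.Quotient.mk_eq_zero] at h2
    obtain ⟨y, rfl⟩ := mem_span_singleton_smul_top.1 h2
    refine Submodule.smul_mem_smul (Ideal.mem_span_singleton_self t) (htK _ ?_)
    rw [← map_smul]
    exact hx
  exact ⟨LinearEquiv.ofBijective φ ⟨LinearMap.ker_eq_bot.1 hinj, LinearMap.range_eq_top.1 hsurj⟩⟩

end Canonical

section GenericElement

variable {R : Type*} [CommRing R]

theorem Ideal.length_quotient_le_of_le {S : Type*} [CommRing S] [Algebra R S] {I J : Ideal S}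
    (h : I ≤ J) : Module.length R (S ⧸ J) ≤ Module.length R (S ⧸ I) :=
  Module.length_le_of_surjective ((Submodule.factor h).restrictScalars R)
    (Submodule.factor_surjective h)

theorem Ideal.eq_of_le_of_length_quotient_le {S : Type*} [CommRing S] [Algebra R S] {I J : Ideal S}
    (h : I ≤ J) (hJ : Module.length R (S ⧸ J) ≠ ⊤)
    (hlen : Module.length R (S ⧸ I) ≤ Module.length R (S ⧸ J)) : I = J := by
  by_contra hne
  rw [← (Submodule.Quotient.restrictScalarsEquiv R I).length_eq,
    ← (Submodule.Quotient.restrictScalarsEquiv R J).length_eq,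
    Module.length_quotient, Module.length_quotient] at *
  exact (Order.coheight_strictAnti (α := Submodule R S) (x := J.restrictScalars R)
    (y := I.restrictScalars R) (lt_of_le_of_ne h (by simpa using hne)) hJ.lt_top).not_ge hlen

open MvPolynomial in
theorem exists_eval_single_eq_one_and_le {ι : Type*} [Fintype ι] [DecidableEq ι] (a : ι → R)
    (W Q : Ideal R) (i : ι) (hW : W.FG) (h : ∀ l, ∀ w ∈ W, a l * w ∈ Ideal.span {a i} * W ⊔ Q) :
    ∃ δ : MvPolynomial ι R, eval (Pi.single i 1) δ = 1 ∧
      Ideal.span {δ} * (Ideal.span {C (a i)} * W.map C) ≤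
        Ideal.span {∑ l, X l * C (a l)} * W.map C ⊔ Q.map C := by
  obtain ⟨k, w, rfl⟩ := Submodule.fg_iff_exists_fin_generating_family.1 hW
  set W : Ideal R := Submodule.span R (Set.range w) with hWdef
  have hw (b) : w b ∈ W := Submodule.subset_span ⟨b, rfl⟩
  set y : MvPolynomial ι R := ∑ l, X l * C (a l) with hy
  set J := Ideal.span {y} * W.map C ⊔ Q.map C with hJ
  have key (l : ι) (b : Fin k) : ∃ θ : Fin k → R, a l * w b - a i * ∑ c, θ c * w c ∈ Q ∧
      (l = i → θ = Pi.single b 1) := by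
    by_cases hl : l = i
    · exact ⟨Pi.single b 1, by simp [hl, Pi.single_apply], fun _ => rfl⟩
    · obtain ⟨x, hx, q, hq, hxq⟩ := Submodule.mem_sup.1 (h l _ (hw b))
      obtain ⟨z, hz, rfl⟩ := Ideal.mem_span_singleton_mul.1 hx
      obtain ⟨θ, rfl⟩ := (Submodule.mem_span_range_iff_exists_fun R).1 hz
      refine ⟨θ, ?_, fun h => (hl h).elim⟩
      rw [← hxq]
      simpa using hq
  choose θ hθ hθi using key
  let Θ : Matrix (Fin k) (Fin k) (MvPolynomial ι R) := Matrix.of fun b c => ∑ l, X l * C (θ l b c)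
  let v : Fin k → MvPolynomial ι R := fun c => C (a i) * C (w c)
  have hΘv (b) : (Θ.mulVec v) b ∈ J := by
    have h1 : (Θ.mulVec v) b =
        y * C (w b) - ∑ l, X l * C (a l * w b - a i * ∑ c, θ l b c * w c) := by
      simp only [Matrix.mulVec, dotProduct, Θ, v, Matrix.of_apply, hy, map_sub, map_mul, map_sum,
        mul_sub, Finset.sum_sub_distrib, Finset.sum_mul, Finset.mul_sum]
      rw [Finset.sum_comm]
      simp only [mul_assoc, sub_sub_cancel]
      refine Finset.sum_congr rfl fun l _ => ?_
      refine Finset.sum_congr rfl fun c _ => ?_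
      ring
    rw [h1]
    refine sub_mem (Ideal.mem_sup_left (Ideal.mul_mem_mul (Ideal.mem_span_singleton_self _)
      (Ideal.mem_map_of_mem _ (hw b)))) (Ideal.mem_sup_right (sum_mem fun l _ =>
        Ideal.mul_mem_left _ _ (Ideal.mem_map_of_mem _ (hθ l b))))
  refine ⟨Θ.det, ?_, ?_⟩
  · rw [RingHom.map_det, ← Matrix.det_one (n := Fin k)]
    congr 1
    ext b c
    simp [Θ, Pi.single_apply, hθi i b rfl, Matrix.one_apply, eq_comm]
  · rw [hWdef, Ideal.submodule_span_eq, Ideal.map_span, Ideal.span_mul_span, Ideal.span_mul_span,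
      Ideal.span_le]
    rintro _ ⟨_, rfl, _, ⟨_, rfl, _, ⟨_, ⟨b, rfl⟩, rfl⟩, rfl⟩, rfl⟩
    have h2 : (Θ.adjugate.mulVec (Θ.mulVec v)) b = Θ.det * v b := by
      rw [Matrix.mulVec_mulVec, Matrix.adjugate_mul, Matrix.smul_mulVec, Matrix.one_mulVec]
      rfl
    change Θ.det * v b ∈ J
    rw [← h2]
    change ∑ c, Θ.adjugate b c * (Θ.mulVec v) c ∈ J
    exact sum_mem fun c _ => Ideal.mul_mem_left _ _ (hΘv c)

open MvPolynomial in
/-- If the colength of `p m ^ j + Q` is at least that of `Q` minus `j`, then a general linear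
combination `y` of the generators of `m` satisfies `p m ^ j ⊆ p y m ^ (j - 1) + Q`, after
multiplication with a polynomial that is nonzero over the residue field. -/
theorem exists_map_residue_ne_zero_and_le [IsLocalRing R] [IsNoetherianRing R] {ι : Type*}
    [Fintype ι] (a : ι → R) (ha : Ideal.span (Set.range a) = maximalIdeal R) (Q : Ideal R)
    (hQ : Module.length R (R ⧸ Q) ≠ ⊤) (j : ℕ) (p : R)
    (h : Module.length R (R ⧸ Q) ≤
      Module.length R (R ⧸ (Ideal.span {p} * maximalIdeal R ^ j ⊔ Q)) + j) :
    ∃ δ : MvPolynomial ι R, map (residue R) δ ≠ 0 ∧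
      Ideal.span {δ} * (Ideal.span {p} * maximalIdeal R ^ j).map C ≤
        Ideal.span {∑ l, X l * C (a l)} * (Ideal.span {p} * maximalIdeal R ^ (j - 1)).map C ⊔
          Q.map C := by
  classical
  induction j generalizing p with
  | zero =>
    have hp := Ideal.eq_of_le_of_length_quotient_le (I := Q)
      (J := Ideal.span {p} * maximalIdeal R ^ 0 ⊔ Q) le_sup_right
      (ne_top_of_le_ne_top hQ (Ideal.length_quotient_le_of_le le_sup_right)) (by simpa using h)
    refine ⟨1, by simp, ?_⟩
    rw [Ideal.span_singleton_one, Ideal.one_eq_top.symm, one_mul]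
    exact (Ideal.map_mono (le_sup_left.trans hp.ge)).trans le_sup_right
  | succ j ih =>
    set m := maximalIdeal R with hm
    have hsum : m ^ (j + 1) = ⨆ i, Ideal.span {a i} * m ^ j := by
      rw [← Ideal.iSup_mul, ← Submodule.span_range_eq_iSup, Ideal.submodule_span_eq, ha, pow_succ']
    have hai (i) : a i ∈ m := ha ▸ Ideal.subset_span ⟨i, rfl⟩
    by_cases hall : ∀ i, Module.length R (R ⧸ Q) ≤
        Module.length R (R ⧸ (Ideal.span {a i * p} * m ^ j ⊔ Q)) + j
    · choose δ hδ hle using fun i => ih (a i * p) (hall i)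
      refine ⟨∏ i, δ i, by simpa [map_prod, Finset.prod_eq_zero_iff] using hδ, ?_⟩
      rw [hsum, Ideal.mul_iSup, Ideal.map_iSup, Ideal.mul_iSup]
      refine iSup_le fun i => ?_
      rw [← mul_assoc, Ideal.span_singleton_mul_span_singleton, mul_comm p]
      refine (Ideal.mul_mono_left ?_).trans ((hle i).trans (sup_le_sup_right
        (Ideal.mul_mono_right (Ideal.map_mono ?_)) _))
      · exact Ideal.span_singleton_le_span_singleton.2 (Finset.dvd_prod_of_mem _
        (Finset.mem_univ i))
      · rw [mul_comm (a i), ← Ideal.span_singleton_mul_span_singleton, mul_assoc]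
        refine Ideal.mul_mono_right ?_
        rcases j with _ | j
        · simp
        · rw [Nat.add_sub_cancel, Nat.add_sub_cancel, pow_succ']
          exact Ideal.mul_mono_left ((Ideal.span_singleton_le_iff_mem _).2 (hai i))
    · push Not at hall
      obtain ⟨i, hi⟩ := hall
      have hle : Ideal.span {a i * p} * m ^ j ⊔ Q ≤ Ideal.span {p} * m ^ (j + 1) ⊔ Q := by
        refine sup_le_sup_right ?_ _
        rw [mul_comm (a i), ← Ideal.span_singleton_mul_span_singleton, mul_assoc, pow_succ']
        exact Ideal.mul_mono_right (Ideal.mul_mono_left ((Ideal.span_singleton_le_iff_mem _).2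
          (hai i)))
      have heq := Ideal.eq_of_le_of_length_quotient_le hle
        (ne_top_of_le_ne_top hQ (Ideal.length_quotient_le_of_le le_sup_right)) (by
          have h1 := ne_top_of_le_ne_top hQ (Ideal.length_quotient_le_of_le
            (le_sup_right : Q ≤ Ideal.span {p} * m ^ (j + 1) ⊔ Q))
          have h2 := ne_top_of_le_ne_top hQ (Ideal.length_quotient_le_of_le
            (le_sup_right : Q ≤ Ideal.span {a i * p} * m ^ j ⊔ Q))
          revert h hi
          generalize Module.length R (R ⧸ Q) = x at hQ
          generalize Module.length R (R ⧸ (Ideal.span {p} * m ^ (j + 1) ⊔ Q)) = x1 at h1 ⊢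
          generalize Module.length R (R ⧸ (Ideal.span {a i * p} * m ^ j ⊔ Q)) = x2 at h2 ⊢
          lift x to ℕ using hQ
          lift x1 to ℕ using h1
          lift x2 to ℕ using h2
          norm_cast
          omega)
      obtain ⟨δ, hδ, hδle⟩ := exists_eval_single_eq_one_and_le a (Ideal.span {p} * m ^ j) Q i
        (IsNoetherian.noetherian _) (fun l w hw => by
          have h1 : a l * w ∈ Ideal.span {p} * m ^ (j + 1) := by
            rw [pow_succ', mul_left_comm]
            exact Ideal.mul_mem_mul (hai l) hw
          have h2 := Ideal.mem_sup_left (T := Q) h1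
          rwa [← heq, ← Ideal.span_singleton_mul_span_singleton, mul_assoc] at h2)
      refine ⟨δ, fun h0 => ?_, ?_⟩
      · have h1 : residue R (MvPolynomial.eval (Pi.single i 1) δ) =
            MvPolynomial.eval (residue R ∘ Pi.single i 1) (map (residue R) δ) := by
          rw [MvPolynomial.eval_map, MvPolynomial.eval, coe_eval₂Hom, eval₂_comp_left,
            RingHom.comp_id]
        rw [hδ, h0] at h1
        simp at h1
      · have h1 := (le_sup_left.trans heq.ge : Ideal.span {p} * m ^ (j + 1) ≤ _)
        refine (Ideal.mul_mono_right (Ideal.map_mono h1)).trans ?_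
        rw [Ideal.map_sup, Ideal.mul_sup, ← Ideal.span_singleton_mul_span_singleton, mul_assoc,
          Ideal.map_mul, Ideal.map_span, Set.image_singleton]
        exact sup_le hδle (Ideal.mul_le_right.trans le_sup_right)

end GenericElement

section Specialization

variable {R : Type u} [CommRing R] [IsLocalRing R] {ι : Type*}

open Polynomial in
theorem exists_aeval_map_residue_ne_zero (δ : MvPolynomial ι R)
    (hδ : MvPolynomial.map (residue R) δ ≠ 0) :
    ∃ γ : ι → R[X], (MvPolynomial.aeval γ δ).map (residue R) ≠ 0 := by
  set δ' : MvPolynomial ι (ResidueField R)[X] :=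
    MvPolynomial.map C (MvPolynomial.map (residue R) δ) with hδ'
  have h0 : δ' ≠ 0 := fun h => hδ (MvPolynomial.map_injective C C_injective (by simpa using h))
  obtain ⟨c, hc⟩ : ∃ c, MvPolynomial.eval c δ' ≠ 0 := by
    by_contra! h
    exact h0 (MvPolynomial.funext fun c => by simpa using h c)
  choose γ hγ using fun i => Polynomial.map_surjective (residue R) residue_surjective (c i)
  refine ⟨γ, ?_⟩
  convert hc using 1
  rw [hδ', MvPolynomial.map_map, MvPolynomial.eval_map, MvPolynomial.aeval_def,
    ← coe_mapRingHom, MvPolynomial.eval₂_comp_left]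
  congr 1
  · ext r
    simp
  · ext i : 1
    exact hγ i

open Polynomial in
theorem exists_finite_free_aeval_isUnit (δ : MvPolynomial ι R)
    (hδ : MvPolynomial.map (residue R) δ ≠ 0) :
    ∃ (S : Type u) (_ : CommRing S) (_ : Algebra R S),
      Nontrivial S ∧ Module.Free R S ∧ Module.Finite R S ∧ ∃ c : ι → S,
        Ideal.span {MvPolynomial.aeval c δ} ⊔ (maximalIdeal R).map (algebraMap R S) = ⊤ := by
  obtain ⟨γ, hγ⟩ := exists_aeval_map_residue_ne_zero δ hδ
  set η := MvPolynomial.aeval γ δ with hη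
  set q : (ResidueField R)[X] := X * η.map (residue R) + 1 with hq
  have hdeg : q.natDegree = (η.map (residue R)).natDegree + 1 := by
    rw [hq, natDegree_add_eq_left_of_natDegree_lt] <;> rw [natDegree_X_mul hγ]
    simp
  have hq0 : q ≠ 0 := by
    rintro h
    simp [h] at hdeg
  obtain ⟨u, hu⟩ := residue_surjective (R := R) q.leadingCoeff⁻¹
  have hu0 : residue R u ≠ 0 := by rw [hu]; exact inv_ne_zero (leadingCoeff_ne_zero.2 hq0)
  obtain ⟨g, hg, hgdeg, hgm⟩ := lifts_and_natDegree_eq_and_monic (f := residue R)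
    (p := q * C q.leadingCoeff⁻¹)
    ((mem_lifts _).2 (Polynomial.map_surjective _ residue_surjective _))
    (monic_mul_leadingCoeff_inv hq0)
  have hker : C u * (X * η + 1) - g ∈ (maximalIdeal R).map C := by
    rw [← ker_residue, ← ker_mapRingHom, RingHom.mem_ker]
    simp [hg, hu, ← hq, mul_comm]
  have : Nontrivial (AdjoinRoot g) :=
    ⟨_, _, (AdjoinRoot.powerBasis' hgm).basis.ne_zero ⟨0, by
      rw [AdjoinRoot.powerBasis'_dim, hgdeg, natDegree_mul_C (by simpa using hq0), hdeg]; omega⟩⟩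
  refine ⟨AdjoinRoot g, inferInstance, inferInstance, this, hgm.free_adjoinRoot,
    hgm.finite_adjoinRoot, fun i => AdjoinRoot.mk g (γ i), ?_⟩
  have h1 := Ideal.mem_map_of_mem (AdjoinRoot.mk g) hker
  rw [map_sub, AdjoinRoot.mk_self, sub_zero, map_mul, Ideal.map_map] at h1
  replace h1 := (Ideal.unit_mul_mem_iff_mem _ (((residue_ne_zero_iff_isUnit u).1 hu0).map
    ((AdjoinRoot.mk g).comp C))).1 h1
  have h2 : MvPolynomial.aeval (fun i => AdjoinRoot.mk g (γ i)) δ = AdjoinRoot.mk g η :=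
    (MvPolynomial.comp_aeval_apply γ (AdjoinRoot.mkₐ g) δ).symm
  rw [Ideal.eq_top_iff_one, h2, Submodule.mem_sup]
  refine ⟨_, Ideal.mul_mem_left _ (-AdjoinRoot.mk g X) (Ideal.mem_span_singleton_self _), _, h1, ?_⟩
  simp

theorem pow_le_of_span_singleton_mul_pow_le [IsNoetherianRing R] {S : Type*} [CommRing S]
    [Algebra R S] [Module.Finite R S] {n : ℕ} {J : Ideal S} {η : S}
    (hη : Ideal.span {η} ⊔ (maximalIdeal R).map (algebraMap R S) = ⊤)
    (h : Ideal.span {η} * (maximalIdeal R).map (algebraMap R S) ^ n ≤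
      J ⊔ (maximalIdeal R).map (algebraMap R S) ^ (n + 1)) :
    (maximalIdeal R).map (algebraMap R S) ^ n ≤ J := by
  set M := (maximalIdeal R).map (algebraMap R S) with hM
  have h1 : M ^ n ≤ J ⊔ M • M ^ n := by
    rw [smul_eq_mul, ← pow_succ']
    calc M ^ n = Ideal.span {η} * M ^ n ⊔ M * M ^ n := by rw [← Ideal.sup_mul, hη, Ideal.top_mul]
      _ ≤ J ⊔ M ^ (n + 1) := sup_le h (by rw [← pow_succ']; exact le_sup_right)
  have := Submodule.le_of_le_smul_of_le_jacobson_bot (I := maximalIdeal R)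
    (N := J.restrictScalars R) (N' := (M ^ n).restrictScalars R)
    (IsNoetherian.noetherian _) (by rw [jacobson_eq_maximalIdeal _ bot_ne_top]) (by
      rw [← Ideal.smul_restrictScalars]
      intro x hx
      obtain ⟨y, hy, z, hz, rfl⟩ := Submodule.mem_sup.1 (h1 hx)
      exact Submodule.add_mem_sup hy hz)
  exact this

/-- After a finite free extension, some power of the maximal ideal of `R` has a principal
reduction. -/
theorem exists_finite_free_reduction [IsNoetherianRing R] (n : ℕ)
    (hfin : Module.length R (R ⧸ maximalIdeal R ^ (n + 1)) ≠ ⊤)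
    (h : Module.length R (R ⧸ maximalIdeal R ^ (n + 1)) ≤
      Module.length R (R ⧸ maximalIdeal R ^ n) + n) :
    ∃ (S : Type u) (_ : CommRing S) (_ : Algebra R S),
      Nontrivial S ∧ Module.Free R S ∧ Module.Finite R S ∧
        ∃ y ∈ (maximalIdeal R).map (algebraMap R S),
          (maximalIdeal R).map (algebraMap R S) ^ n ≤
            Ideal.span {y} * (maximalIdeal R).map (algebraMap R S) ^ (n - 1) := by
  obtain ⟨k, a, ha⟩ := Submodule.fg_iff_exists_fin_generating_family.1
    (IsNoetherian.noetherian (maximalIdeal R))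
  obtain ⟨δ, hδ, hle⟩ := exists_map_residue_ne_zero_and_le a ha _ hfin n 1 (by
    rwa [Ideal.span_singleton_one, Ideal.top_mul,
      sup_eq_left.2 (Ideal.pow_le_pow_right n.le_succ)])
  obtain ⟨S, _, _, h1, h2, h3, c, hc⟩ := exists_finite_free_aeval_isUnit δ hδ
  refine ⟨S, inferInstance, inferInstance, h1, h2, h3,
    MvPolynomial.aeval c (∑ l, MvPolynomial.X l * MvPolynomial.C (a l)), ?_, ?_⟩
  · rw [map_sum]
    refine sum_mem fun l _ => ?_
    rw [map_mul, MvPolynomial.aeval_C]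
    exact Ideal.mul_mem_left _ _ (Ideal.mem_map_of_mem _ (ha ▸ Submodule.subset_span ⟨l, rfl⟩))
  · refine pow_le_of_span_singleton_mul_pow_le hc ?_
    have hcomp : (MvPolynomial.aeval c : MvPolynomial (Fin k) R →ₐ[R] S).toRingHom.comp
        MvPolynomial.C = algebraMap R S := (MvPolynomial.aeval c).comp_algebraMap
    have := Ideal.map_mono (f := (MvPolynomial.aeval c : MvPolynomial (Fin k) R →ₐ[R] S).toRingHom)
      hle
    simp only [Ideal.map_mul, Ideal.map_sup, Ideal.map_map, hcomp, Ideal.map_span, Ideal.map_pow,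
      Set.image_singleton, Ideal.span_singleton_one, ← Ideal.one_eq_top, one_mul] at this
    exact this

end Specialization

section ColengthAlgebra

variable {R S : Type*} [CommRing R] [CommRing S] [Algebra R S]

open Pointwise in
theorem Ideal.length_quotient_span_singleton_mul {y : S} (hy : y ∈ nonZeroDivisors S)
    (J : Ideal S) : Module.length R (S ⧸ Ideal.span {y} * J) =
      Module.length R (S ⧸ J) + Module.length R (S ⧸ Ideal.span {y}) := by
  have h : Ideal.span {y} * J = y • J := by
    rw [← smul_eq_mul, Submodule.ideal_span_singleton_smul]
  rw [h]
  exact Module.length_eq_add_of_exact ((Ideal.mulQuot y J).restrictScalars R)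
    ((Ideal.quotOfMul y J).restrictScalars R) (Ideal.mulQuot_injective J hy)
    (Ideal.quotOfMul_surjective J) (Ideal.exact_mulQuot_quotOfMul J)

theorem Module.Basis.mem_map_algebraMap_iff {ι : Type*} [Fintype ι] (b : Module.Basis ι R S)
    {N : Ideal R} {x : S} : x ∈ N.map (algebraMap R S) ↔ ∀ i, b.repr x i ∈ N := by
  constructor
  · intro hx i
    have h : (N.map (algebraMap R S)).restrictScalars R ≤ Submodule.comap (b.coord i) N := by
      rw [← Ideal.smul_top_eq_map, Submodule.smul_le]
      intro a ha n _
      simpa using N.mul_mem_right _ ha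
    exact h hx
  · intro h
    rw [← b.sum_repr x]
    refine sum_mem fun i _ => ?_
    rw [Algebra.smul_def]
    exact Ideal.mul_mem_right _ _ (Ideal.mem_map_of_mem _ (h i))

theorem Ideal.length_quotient_map_algebraMap [Nontrivial R] [Module.Free R S] [Module.Finite R S]
    (N : Ideal R) : Module.length R (S ⧸ N.map (algebraMap R S)) =
      Module.finrank R S * Module.length R (R ⧸ N) := by
  let b := Module.finBasis R S
  let f : S →ₗ[R] (Fin (Module.finrank R S) → R ⧸ N) :=
    (N.mkQ.compLeft _) ∘ₗ b.equivFun.toLinearMap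
  have hf : Function.Surjective f := (N.mkQ_surjective.comp_left).comp b.equivFun.surjective
  have hker : LinearMap.ker f = (N.map (algebraMap R S)).restrictScalars R := by
    ext x
    rw [Submodule.restrictScalars_mem, b.mem_map_algebraMap_iff, LinearMap.mem_ker, funext_iff]
    exact forall_congr' fun i => Submodule.Quotient.mk_eq_zero N
  rw [← (Submodule.Quotient.restrictScalarsEquiv R (N.map (algebraMap R S))).length_eq, ← hker,
    (f.quotKerEquivOfSurjective hf).length_eq, Module.length_pi_of_fintype]
  simp

/-- The natural map `I / J I → R / J I`. -/
def Ideal.smulTopQuotientMap (J I : Ideal R) :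
    (I ⧸ J • (⊤ : Submodule R I)) →ₗ[R] R ⧸ J * I :=
  Submodule.mapQ _ _ I.subtype (by
    rw [← Submodule.map_le_iff_le_comap, Submodule.map_smul'', Submodule.map_top,
      Submodule.range_subtype]
    exact le_rfl)

theorem Ideal.smulTopQuotientMap_injective (J I : Ideal R) :
    Function.Injective (J.smulTopQuotientMap I) := by
  rw [← LinearMap.ker_eq_bot, Ideal.smulTopQuotientMap, Submodule.mapQ, Submodule.ker_liftQ_eq_bot']
  rw [LinearMap.ker_comp, Submodule.ker_mkQ]
  apply Submodule.map_injective_of_injective I.subtype_injective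
  rw [Submodule.map_smul'', Submodule.map_top, Submodule.range_subtype,
    Submodule.map_comap_subtype, inf_eq_right.2 Ideal.mul_le_right]
  rfl

theorem Ideal.range_smulTopQuotientMap (J I : Ideal R) :
    LinearMap.range (J.smulTopQuotientMap I) = Submodule.map (J * I).mkQ I := by
  rw [Ideal.smulTopQuotientMap, Submodule.range_mapQ, Submodule.range_subtype]

theorem Ideal.length_smul_top_quotient_add (J I : Ideal R) :
    Module.length R (I ⧸ J • (⊤ : Submodule R I)) + Module.length R (R ⧸ I) =
      Module.length R (R ⧸ J * I) := by
  refine (Module.length_eq_add_of_exact (J.smulTopQuotientMap I)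
    (Submodule.factor Ideal.mul_le_right) (J.smulTopQuotientMap_injective I)
    (Submodule.factor_surjective _) ?_).symm
  rw [LinearMap.exact_iff, J.range_smulTopQuotientMap, Submodule.factor, Submodule.ker_mapQ,
    Submodule.comap_id]

end ColengthAlgebra

section SocleLength

variable {R : Type*} [CommRing R] [IsLocalRing R]

theorem length_socle_add {Q : Type*} [AddCommGroup Q] [Module R Q] {L I : Ideal R} (hLI : L ≤ I)
    (g : Q →ₗ[R] R ⧸ L) (hg : Function.Injective g)
    (hrange : LinearMap.range g = Submodule.map L.mkQ I) :
    Module.length R (socle R Q) + Module.length R (R ⧸ (I ⊓ L.colon (maximalIdeal R : Set R))) =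
      Module.length R (R ⧸ L) := by
  have hL : L ≤ I ⊓ L.colon (maximalIdeal R : Set R) :=
    le_inf hLI fun x hx => Submodule.mem_colon.2 fun a _ => L.mul_mem_right _ hx
  refine (Module.length_eq_add_of_exact (g ∘ₗ (socle R Q).subtype) (Submodule.factor hL)
    (hg.comp (socle R Q).subtype_injective) (Submodule.factor_surjective _) ?_).symm
  rw [LinearMap.exact_iff, Submodule.factor, Submodule.ker_mapQ, Submodule.comap_id]
  ext x
  constructor
  · rintro ⟨x, ⟨hxI, hx⟩, rfl⟩
    obtain ⟨q, hq⟩ : L.mkQ x ∈ LinearMap.range g := hrange ▸ Submodule.mem_map_of_mem hxI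
    refine ⟨⟨q, mem_socle.2 fun a ha => hg ?_⟩, hq⟩
    rw [map_smul, hq, ← map_smul, map_zero, Submodule.mkQ_apply, Submodule.Quotient.mk_eq_zero]
    rw [smul_eq_mul, mul_comm]
    exact Submodule.mem_colon.1 hx a ha
  · rintro ⟨⟨q, hq⟩, rfl⟩
    obtain ⟨x, hxI, hx⟩ : g q ∈ Submodule.map L.mkQ I := hrange ▸ LinearMap.mem_range_self g q
    refine ⟨x, ⟨hxI, Submodule.mem_colon.2 fun a ha => ?_⟩, hx⟩
    have h := congrArg g (mem_socle.1 hq a ha)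
    rw [map_smul, ← hx, ← map_smul, map_zero, Submodule.mkQ_apply, Submodule.Quotient.mk_eq_zero]
      at h
    rwa [smul_eq_mul, mul_comm, ← smul_eq_mul]

theorem length_socle_smul_top_quotient_add (J I : Ideal R) :
    Module.length R (socle R (I ⧸ J • (⊤ : Submodule R I))) +
      Module.length R (R ⧸ (I ⊓ (J * I).colon (maximalIdeal R : Set R))) =
        Module.length R (R ⧸ J * I) :=
  length_socle_add Ideal.mul_le_right _ (J.smulTopQuotientMap_injective I)
    (J.range_smulTopQuotientMap I)

theorem length_socle_quotient_add (J : Ideal R) :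
    Module.length R (socle R (R ⧸ J)) +
      Module.length R (R ⧸ J.colon (maximalIdeal R : Set R)) = Module.length R (R ⧸ J) := by
  have := length_socle_add (le_top : J ≤ ⊤) LinearMap.id Function.injective_id (by
    rw [LinearMap.range_id, Submodule.map_top, Submodule.range_mkQ])
  rwa [top_inf_eq] at this

end SocleLength

section Reduction

theorem length_quotient_maximalIdeal (R : Type*) [CommRing R] [IsLocalRing R] :
    Module.length R (R ⧸ maximalIdeal R) = 1 :=
  Module.length_eq_one_iff.2 (isSimpleModule_iff_isCoatom.2 (maximalIdeal.isMaximal R).out)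

theorem algebraMap_mem_nonZeroDivisors {R S : Type*} [CommRing R] [CommRing S] [Algebra R S]
    [Module.Free R S] {t : R} (ht : t ∈ nonZeroDivisors R) :
    algebraMap R S t ∈ nonZeroDivisors S := by
  refine mem_nonZeroDivisors_iff_right.2 fun x hx => ?_
  let b := Module.Free.chooseBasis R S
  refine b.ext_elem fun i => ?_
  rw [mul_comm, ← Algebra.smul_def] at hx
  have h := congrArg (fun x => b.repr x i) hx
  simp only [map_smul, Finsupp.smul_apply, smul_eq_mul, map_zero, Finsupp.zero_apply] at h ⊢
  exact (mem_nonZeroDivisors_iff.1 ht).1 _ h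

variable {R S : Type*} [CommRing R] [IsLocalRing R] [CommRing S] [Algebra R S]
  [Module.Free R S] [Module.Finite R S] {t : R} {y z : S} {e : ℕ}

theorem exists_reduction_parameter [IsNoetherianRing R] {n : ℕ} (hn : n ≠ 0)
    (hfin : ∀ k, Module.length R (R ⧸ maximalIdeal R ^ k) ≠ ⊤)
    (hmult : Module.length R (R ⧸ maximalIdeal R ^ n) =
      Module.length R (R ⧸ maximalIdeal R ^ (n - 1)) + e)
    (he : minGen R (maximalIdeal R : Submodule R R) = e)
    (hy : y ∈ (maximalIdeal R).map (algebraMap R S))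
    (hle : (maximalIdeal R).map (algebraMap R S) ^ n ≤
            Ideal.span {y} * (maximalIdeal R).map (algebraMap R S) ^ (n - 1))
    (ht : t ∈ maximalIdeal R ^ n) (ht0 : t ∈ nonZeroDivisors R) :
    ∃ z : S, algebraMap R S t = y * z ∧ y ∈ nonZeroDivisors S ∧ z ∈ nonZeroDivisors S ∧
      Module.length R (S ⧸ Ideal.span {y}) = Module.finrank R S * e ∧
      (maximalIdeal R).map (algebraMap R S) ^ 2 =
        Ideal.span {y} * (maximalIdeal R).map (algebraMap R S) := by
  set M := (maximalIdeal R).map (algebraMap R S) with hM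
  have htM : algebraMap R S t ∈ M ^ n := by
    rw [hM, ← Ideal.map_pow]
    exact Ideal.mem_map_of_mem _ ht
  obtain ⟨z, -, hz⟩ := Ideal.mem_span_singleton_mul.1 (hle htM)
  have htS : algebraMap R S t ∈ nonZeroDivisors S := algebraMap_mem_nonZeroDivisors ht0
  rw [← hz, mul_mem_nonZeroDivisors] at htS
  have hlen (k) : Module.length R (S ⧸ M ^ k) =
      Module.finrank R S * Module.length R (R ⧸ maximalIdeal R ^ k) := by
    rw [hM, ← Ideal.map_pow, Ideal.length_quotient_map_algebraMap]
  have hnle (k) (hk : k ≠ 0) : Ideal.span {y} * M ^ (k - 1) ≤ M ^ k := by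
    obtain ⟨k, rfl⟩ := Nat.exists_eq_succ_of_ne_zero hk
    rw [Nat.succ_sub_one, Nat.succ_eq_add_one, pow_succ']
    exact Ideal.mul_mono_left ((Ideal.span_singleton_le_iff_mem _).2 hy)
  have hyl : Module.length R (S ⧸ Ideal.span {y}) = Module.finrank R S * e := by
    have h1 := Ideal.length_quotient_span_singleton_mul (R := R) htS.1 (M ^ (n - 1))
    rw [(hnle n hn).antisymm hle, hlen, hlen, hmult, mul_add] at h1
    exact (ENat.add_right_injective_of_ne_top (WithTop.mul_ne_top (ENat.natCast_ne_top _) (hfin _))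
      h1).symm
  refine ⟨z, hz.symm, htS.1, htS.2, hyl, Eq.symm ?_⟩
  have hm2 : Module.length R (R ⧸ maximalIdeal R ^ 2) = e + 1 := by
    have h := Ideal.length_smul_top_quotient_add (maximalIdeal R) (maximalIdeal R)
    rw [← sq, ← minGen_eq_length (IsNoetherian.noetherian _), he] at h
    rw [← h, length_quotient_maximalIdeal]
  have := hnle 2 two_ne_zero
  rw [pow_one] at this
  refine Ideal.eq_of_le_of_length_quotient_le (R := R) this ?_ ?_
  · rw [hlen]
    exact WithTop.mul_ne_top (ENat.natCast_ne_top _) (hfin _)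
  · have h1 : Module.length R (S ⧸ M) = Module.finrank R S := by
      rw [hM, Ideal.length_quotient_map_algebraMap, length_quotient_maximalIdeal, mul_one]
    rw [Ideal.length_quotient_span_singleton_mul htS.1,
      hlen, hm2, hyl, h1, mul_add, mul_one, add_comm]

theorem mem_map_algebraMap_colon {I L : Ideal R} {x : S} (hx : x ∈ I.map (algebraMap R S))
    (h : ∀ a ∈ maximalIdeal R, algebraMap R S a * x ∈ L.map (algebraMap R S)) :
    x ∈ (I ⊓ L.colon (maximalIdeal R : Set R)).map (algebraMap R S) := by
  let b := Module.finBasis R S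
  rw [b.mem_map_algebraMap_iff] at hx ⊢
  refine fun i => ⟨hx i, Submodule.mem_colon.2 fun a ha => ?_⟩
  have := b.mem_map_algebraMap_iff.1 (h a ha) i
  rw [← Algebra.smul_def, map_smul, Finsupp.smul_apply] at this
  rwa [smul_eq_mul, mul_comm, ← smul_eq_mul]

theorem finrank_mul_length_quotient (hyz : algebraMap R S t = y * z) (hy : y ∈ nonZeroDivisors S)
    (hyl : Module.length R (S ⧸ Ideal.span {y}) = Module.finrank R S * e) :
    Module.finrank R S * Module.length R (R ⧸ Ideal.span {t}) =
      Module.length R (S ⧸ Ideal.span {z}) + Module.finrank R S * e := by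
  rw [← hyl, ← Ideal.length_quotient_span_singleton_mul hy, Ideal.span_singleton_mul_span_singleton,
    ← hyz, ← Ideal.length_quotient_map_algebraMap, Ideal.map_span, Set.image_singleton]

theorem le_length_socle_add_length [Nontrivial S] (hyz : algebraMap R S t = y * z)
    (hy : y ∈ nonZeroDivisors S) (hz : z ∈ nonZeroDivisors S)
    (hyl : Module.length R (S ⧸ Ideal.span {y}) = Module.finrank R S * e)
    (ht : t ∈ nonZeroDivisors R)
    (htR : Module.length R (R ⧸ Ideal.span {t}) ≠ ⊤)
    (hM : (maximalIdeal R).map (algebraMap R S) ^ 2 =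
        Ideal.span {y} * (maximalIdeal R).map (algebraMap R S)) (I : Ideal R)
    (hI : Module.length R (R ⧸ I) ≠ ⊤) :
    e ≤ Module.length R (socle R (I ⧸ Ideal.span {t} • (⊤ : Submodule R I))) +
      Module.length R (I ⧸ maximalIdeal R • (⊤ : Submodule R I)) := by
  have h1 := length_socle_smul_top_quotient_add (Ideal.span {t}) I
  have h2 := Ideal.length_smul_top_quotient_add (maximalIdeal R) I
  have h3 := Ideal.length_quotient_span_singleton_mul (R := R) ht I
  have h4 := finrank_mul_length_quotient hyz hy hyl
  set N := I ⊓ (Ideal.span {t} * I).colon (maximalIdeal R : Set R) with hN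
  have h5 : Module.finrank R S * Module.length R (R ⧸ N) ≤ Module.finrank R S *
      Module.length R (R ⧸ maximalIdeal R * I) + Module.length R (S ⧸ Ideal.span {z}) := by
    rw [← Ideal.length_quotient_map_algebraMap, ← Ideal.length_quotient_map_algebraMap,
      ← Ideal.length_quotient_span_singleton_mul hz]
    refine Ideal.length_quotient_le_of_le fun x hx => mem_map_algebraMap_colon ?_ fun a ha => ?_
    · rw [Ideal.map_mul] at hx
      exact Ideal.mul_le_right (Ideal.mul_le_right hx)
    · have h6 : algebraMap R S a * x ∈ (maximalIdeal R).map (algebraMap R S) *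
          (Ideal.span {z} * (maximalIdeal R * I).map (algebraMap R S)) :=
        Ideal.mul_mem_mul (Ideal.mem_map_of_mem _ ha) hx
      have h7 : (maximalIdeal R).map (algebraMap R S) *
          (Ideal.span {z} * (maximalIdeal R * I).map (algebraMap R S)) =
          (maximalIdeal R).map (algebraMap R S) * (Ideal.span {t} * I).map (algebraMap R S) := by
        rw [Ideal.map_mul, Ideal.map_mul, Ideal.map_span, Set.image_singleton, hyz,
          ← Ideal.span_singleton_mul_span_singleton, mul_left_comm, ← mul_assoc (Ideal.map _ _),
          ← sq,
          hM]
        ring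
      rw [h7] at h6
      exact Ideal.mul_le_right h6
  have hd : 0 < Module.finrank R S := (Module.finrank_pos_iff_of_free R S).2 inferInstance
  generalize Module.finrank R S = d at *
  generalize Module.length R (R ⧸ N) = ν at *
  generalize Module.length R (R ⧸ I) = ι at *
  generalize Module.length R (R ⧸ Ideal.span {t}) = τ at *
  generalize Module.length R (R ⧸ Ideal.span {t} * I) = τ' at *
  generalize Module.length R (S ⧸ Ideal.span {z}) = ζ at *
  generalize Module.length R (R ⧸ maximalIdeal R * I) = μ at *
  generalize Module.length R (socle R (I ⧸ Ideal.span {t} • (⊤ : Submodule R I))) = σ at *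
  generalize Module.length R (I ⧸ maximalIdeal R • (⊤ : Submodule R I)) = l at *
  induction l using ENat.recTopCoe with
  | top => simp
  | coe l =>
    lift ι to ℕ using hI
    lift τ to ℕ using htR
    obtain rfl : τ' = (ι + τ : ℕ) := by simpa using h3
    have hσ : σ ≠ ⊤ := ne_top_of_le_ne_top (ENat.natCast_ne_top _) (le_self_add.trans h1.le)
    have hν : ν ≠ ⊤ := ne_top_of_le_ne_top (ENat.natCast_ne_top _) (le_add_self.trans h1.le)
    have hζ : ζ ≠ ⊤ := ne_top_of_le_ne_top (ENat.natCast_ne_top (d * τ))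
      (le_self_add.trans (by simpa using h4.ge))
    obtain rfl : μ = (l + ι : ℕ) := by simpa using h2.symm
    lift σ to ℕ using hσ
    lift ν to ℕ using hν
    lift ζ to ℕ using hζ
    norm_cast at *
    refine Nat.le_of_mul_le_mul_left ?_ hd
    have := congrArg (d * ·) h1
    simp only [mul_add] at *
    linarith

theorem length_socle_quotient_le [Nontrivial S] (hyz : algebraMap R S t = y * z)
    (hy : y ∈ nonZeroDivisors S) (hz : z ∈ nonZeroDivisors S)
    (hyl : Module.length R (S ⧸ Ideal.span {y}) = Module.finrank R S * e)
    (hyM : y ∈ (maximalIdeal R).map (algebraMap R S))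
    (htR : Module.length R (R ⧸ Ideal.span {t}) ≠ ⊤) {J : Ideal R} {k : ℕ}
    (hJ : Module.length R (R ⧸ J) = k)
    (h : ∀ x ∈ (Ideal.span {t}).colon (maximalIdeal R : Set R), ∀ a ∈ maximalIdeal R,
      x * a ∈ Ideal.span {t} * J) :
    Module.length R (socle R (R ⧸ Ideal.span {t})) + k ≤ e := by
  have h1 := length_socle_quotient_add (Ideal.span {t})
  have h4 := finrank_mul_length_quotient hyz hy hyl
  set N := (Ideal.span {t}).colon (maximalIdeal R : Set R) with hN
  have h5 : Module.length R (S ⧸ Ideal.span {z}) + Module.finrank R S * k ≤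
      Module.finrank R S * Module.length R (R ⧸ N) := by
    rw [← hJ, ← Ideal.length_quotient_map_algebraMap, ← Ideal.length_quotient_map_algebraMap,
      add_comm, ← Ideal.length_quotient_span_singleton_mul hz]
    refine Ideal.length_quotient_le_of_le (Ideal.map_le_iff_le_comap.2 fun x hx => ?_)
    have h6 : y * algebraMap R S x ∈ (Ideal.span {t} * J).map (algebraMap R S) := by
      have h7 := Ideal.mul_mem_mul hyM (Ideal.mem_map_of_mem (algebraMap R S)
        (Ideal.mem_span_singleton_self x))
      rw [← Ideal.map_mul] at h7
      refine Ideal.map_mono ?_ h7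
      rw [Ideal.mul_le]
      intro a ha b hb
      obtain ⟨c, rfl⟩ := Ideal.mem_span_singleton.1 hb
      rw [← mul_assoc, mul_comm a]
      exact Ideal.mul_mem_right _ _ (h x hx a ha)
    rw [Ideal.map_mul, Ideal.map_span, Set.image_singleton, hyz,
      ← Ideal.span_singleton_mul_span_singleton, mul_assoc] at h6
    obtain ⟨w, hw, hyw⟩ := Ideal.mem_span_singleton_mul.1 h6
    rwa [Ideal.mem_comap, ← (mul_cancel_left_mem_nonZeroDivisors hy).1 hyw]
  have hd : 0 < Module.finrank R S := (Module.finrank_pos_iff_of_free R S).2 inferInstance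
  generalize Module.finrank R S = d at *
  generalize Module.length R (R ⧸ N) = ν at *
  generalize Module.length R (socle R (R ⧸ Ideal.span {t})) = σ at *
  generalize Module.length R (R ⧸ Ideal.span {t}) = τ at *
  generalize Module.length R (S ⧸ Ideal.span {z}) = ζ at *
  lift τ to ℕ using htR
  have hσ : σ ≠ ⊤ := ne_top_of_le_ne_top (ENat.natCast_ne_top _) (le_self_add.trans h1.le)
  have hν : ν ≠ ⊤ := ne_top_of_le_ne_top (ENat.natCast_ne_top _) (le_add_self.trans h1.le)
  have hζ : ζ ≠ ⊤ :=
    ne_top_of_le_ne_top (ENat.natCast_ne_top (d * τ)) (le_self_add.trans (by simpa using h4.ge))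
  lift σ to ℕ using hσ
  lift ν to ℕ using hν
  lift ζ to ℕ using hζ
  norm_cast at *
  refine Nat.le_of_mul_le_mul_left ?_ hd
  have := congrArg (d * ·) h1
  simp only [mul_add] at *
  linarith

end Reduction

section Parameter

variable {R : Type u} [CommRing R] [IsLocalRing R]

theorem mul_mem_span_singleton_mul_of_two_le_minGen
    (he : 2 ≤ minGen R (maximalIdeal R : Submodule R R)) {t x a : R} (ht : t ∈ nonZeroDivisors R)
    (hx : x ∈ (Ideal.span {t}).colon (maximalIdeal R : Set R)) (ha : a ∈ maximalIdeal R) :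
    x * a ∈ Ideal.span {t} * maximalIdeal R := by
  obtain ⟨w, hw⟩ := Ideal.mem_span_singleton.1 (Submodule.mem_colon.1 hx a ha)
  rw [smul_eq_mul] at hw
  refine Ideal.mem_span_singleton_mul.2 ⟨w, by_contra fun hwm => ?_, hw.symm⟩
  obtain ⟨w, rfl⟩ : IsUnit w := not_not.1 hwm
  have hx0 : x ∈ nonZeroDivisors R :=
    (mul_mem_nonZeroDivisors.1 (hw ▸ mul_mem ht w.isUnit.mem_nonZeroDivisors)).1
  refine absurd (he.trans (Nat.sInf_le ⟨{a}, Finset.card_singleton a, ?_⟩)) (by decide)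
  rw [Finset.coe_singleton]
  refine le_antisymm ((Ideal.span_singleton_le_iff_mem _).2 ha) fun b hb => ?_
  obtain ⟨c, hc⟩ := Ideal.mem_span_singleton.1 (Submodule.mem_colon.1 hx b hb)
  refine Ideal.mem_span_singleton.2 ⟨↑w⁻¹ * c, (mul_cancel_left_mem_nonZeroDivisors hx0).1 ?_⟩
  rw [← mul_assoc, hw, mul_assoc, Units.mul_inv_cancel_left, ← hc, smul_eq_mul]

/-- If the embedding dimension of `R` equals its multiplicity, then a high power `t` of a parameter
bounds the type of `R` from above, and the number of generators of `I` plus the socle dimension of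
`I / tI` from below, by the multiplicity. -/
theorem exists_parameter [IsNoetherianRing R] [Ring.KrullDimLE 1 R] {e : ℕ}
    (hR : ∃ t ∈ maximalIdeal R, t ∈ nonZeroDivisors R)
    (hmult : IsMultiplicityAt R (maximalIdeal R) e)
    (he : minGen R (maximalIdeal R : Submodule R R) = e) :
    ∃ t ∈ maximalIdeal R, t ∈ nonZeroDivisors R ∧
      Module.length R (socle R (R ⧸ Ideal.span {t})) ≤ e ∧
      (2 ≤ e → Module.length R (socle R (R ⧸ Ideal.span {t})) + 1 ≤ e) ∧
      ∀ I : Ideal R, Module.length R (R ⧸ I) ≠ ⊤ →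
        e ≤ Module.length R (socle R (I ⧸ Ideal.span {t} • (⊤ : Submodule R I))) +
          Module.length R (I ⧸ maximalIdeal R • (⊤ : Submodule R I)) := by
  obtain ⟨t, htm, ht⟩ := hR
  obtain ⟨N, hN⟩ := hmult
  simp only [moduleLength, ← Module.length_eq_height] at hN
  have hfin1 (k : ℕ) : Module.length R (R ⧸ Ideal.span {t ^ k}) ≠ ⊤ :=
    Module.length_ne_top_iff.2 (isFiniteLength_quotient_span_singleton R (pow_mem ht k))
  have hfin (k : ℕ) : Module.length R (R ⧸ maximalIdeal R ^ k) ≠ ⊤ :=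
    ne_top_of_le_ne_top (hfin1 k) (Ideal.length_quotient_le_of_le
      ((Ideal.span_singleton_le_iff_mem _).2 (Ideal.pow_mem_pow htm k)))
  obtain ⟨S, _, _, _, _, _, y, hy, hle⟩ := exists_finite_free_reduction (N + 1 + e) (hfin _) (by
    rw [hN _ (by lia)]
    gcongr
    lia)
  have htn := pow_mem ht (N + 1 + e)
  obtain ⟨z, hyz, hy0, hz0, hyl, hM⟩ := exists_reduction_parameter (by lia) hfin
    (by
      have := hN (N + e) (by lia)
      rwa [add_right_comm N 1 e, Nat.add_sub_cancel]) he hy hle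
    (Ideal.pow_mem_pow htm _) htn
  refine ⟨t ^ (N + 1 + e), Ideal.pow_mem_of_mem _ htm _ (by lia), htn, ?_, fun h2 => ?_, fun I hI =>
    le_length_socle_add_length hyz hy0 hz0 hyl htn (hfin1 _) hM I hI⟩
  · have hJ : Module.length R (R ⧸ (⊤ : Ideal R)) = (0 : ℕ) := Module.length_eq_zero
    have := length_socle_quotient_le hyz hy0 hz0 hyl hy (hfin1 _) hJ fun x hx a ha => by
      rw [Ideal.mul_top]
      exact Submodule.mem_colon.1 hx a ha
    simpa using this
  · have := length_socle_quotient_le hyz hy0 hz0 hyl hy (hfin1 _)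
      (J := maximalIdeal R) (k := 1) (by simpa using length_quotient_maximalIdeal R)
        fun x hx a ha =>
        mul_mem_span_singleton_mul_of_two_le_minGen (he ▸ h2) htn hx ha
    simpa using this

end Parameter

section Faithful

variable {R : Type*} [CommRing R] {I : Ideal R}

theorem exists_mem_nonZeroDivisors_of_annihilator_eq_bot [IsNoetherianRing R]
    (hI : Module.annihilator R I = ⊥) : ∃ x ∈ I, x ∈ nonZeroDivisors R := by
  by_contra! h
  exact (Ideal.bot_lt_annihilator_of_disjoint_nonZeroDivisors (Set.disjoint_left.2 h)).ne' hI

theorem nonempty_linearEquiv_of_span_singleton_eq {x : R} (hx : Ideal.span {x} = I)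
    (hI : Module.annihilator R I = ⊥) : Nonempty (I ≃ₗ[R] R) := by
  have hxI : x ∈ I := hx ▸ Ideal.mem_span_singleton_self x
  refine ⟨(LinearEquiv.ofBijective (LinearMap.toSpanSingleton R I ⟨x, hxI⟩) ⟨?_, ?_⟩).symm⟩
  · refine (injective_iff_map_eq_zero _).2 fun a ha => ?_
    rw [← Ideal.mem_bot, ← hI, Module.mem_annihilator]
    rintro ⟨b, hb⟩
    obtain ⟨c, rfl⟩ := Ideal.mem_span_singleton.1 (hx ▸ hb)
    have ha : a * x = 0 := congrArg Subtype.val ha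
    exact Subtype.ext (by rw [Submodule.coe_smul, smul_eq_mul, ← mul_assoc, ha, zero_mul]; rfl)
  · rintro ⟨b, hb⟩
    obtain ⟨c, rfl⟩ := Ideal.mem_span_singleton.1 (hx ▸ hb)
    exact ⟨c, Subtype.ext (mul_comm c x)⟩

theorem length_quotient_smul_top_eq {t : R} (ht : t ∈ nonZeroDivisors R)
    (hI : Module.length R (R ⧸ I) ≠ ⊤) :
    Module.length R (I ⧸ Ideal.span {t} • (⊤ : Submodule R I)) =
      Module.length R (R ⧸ Ideal.span {t}) := by
  refine ENat.add_right_injective_of_ne_top hI ?_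
  simp only
  rw [← Ideal.length_quotient_span_singleton_mul ht, ← Ideal.length_smul_top_quotient_add, add_comm]

end Faithful

/-- (Theorem 3.3a) Let `R` be a one-dimensional Cohen–Macaulay local ring
with canonical module `K` such that the embedding dimension equals the multiplicity,
`v(R) = e(R)`. Let `I` be a faithful ideal with `r = μ_R(I)`, `s = μ_R(Hom_R(I, K))`.
If `rs = r(R) = μ_R(K)`, then `I ≅ R` or `I ≅ K`. -/
theorem stmt10 (R : Type u) [CommRing R] [IsLocalRing R]
    (hCM : IsOneDimCMLocal R)
    (K : Type u) [AddCommGroup K] [Module R K]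
    (hK : IsCanonicalModuleAt R (IsLocalRing.maximalIdeal R) K)
    (hve : ∃ e : ℕ, IsMultiplicityAt R (IsLocalRing.maximalIdeal R) e ∧
      minGen R (IsLocalRing.maximalIdeal R : Submodule R R) = e)
    (I : Ideal R) (hfaith : Module.annihilator R ↥I = ⊥)
    (r s : ℕ) (hr : r = minGen R (I : Submodule R R))
    (hs : s = minGen R (⊤ : Submodule R (↥I →ₗ[R] K)))
    (hrs : r * s = minGen R (⊤ : Submodule R K)) :
    Nonempty (↥I ≃ₗ[R] R) ∨ Nonempty (↥I ≃ₗ[R] K) := by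
  obtain ⟨_, hdim, hR⟩ := hCM
  obtain ⟨e, hmult, he⟩ := hve
  have : Ring.KrullDimLE 1 R := Ring.krullDimLE_iff.2 hdim.le
  obtain ⟨t, htm, ht, htype, htype', hsum⟩ := exists_parameter hR hmult he
  have htR := isFiniteLength_quotient_span_singleton R ht
  obtain ⟨x, hxI, hx⟩ := exists_mem_nonZeroDivisors_of_annihilator_eq_bot hfaith
  have hI : Module.length R (R ⧸ I) ≠ ⊤ :=
    ne_top_of_le_ne_top (Module.length_ne_top_iff.2 (isFiniteLength_quotient_span_singleton R hx))
      (Ideal.length_quotient_le_of_le ((Ideal.span_singleton_le_iff_mem _).2 hxI))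
  have htI (y : I) (hy : t • y = 0) : y = 0 := Subtype.ext <|
    (mul_left_mem_nonZeroDivisors_eq_zero_iff ht).1 (congrArg Subtype.val hy)
  have hcyclic (h : r ≤ 1) : Nonempty (I ≃ₗ[R] R) := by
    obtain ⟨x, hx⟩ := exists_span_singleton_eq_of_minGen_le_one (IsNoetherian.noetherian I) (hr ▸ h)
    exact nonempty_linearEquiv_of_span_singleton_eq hx hfaith
  have hcocyclic (h : s ≤ 1) : Nonempty (I ≃ₗ[R] K) :=
    hK.nonempty_linearEquiv htm htR htI (length_quotient_smul_top_eq ht hI) (hs ▸ h)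
  have hgen : (r * s : ℕ) ≤ Module.length R (socle R (R ⧸ Ideal.span {t})) :=
    hrs ▸ hK.minGen_le htm htR
  have hadd : (e : ℕ∞) ≤ s + r := by
    refine (hsum I hI).trans (add_le_add (hs ▸ hK.length_socle_le_minGen htm htR htI) ?_)
    rw [hr, minGen_eq_length (IsNoetherian.noetherian I)]
  have hle : r * s ≤ e := by exact_mod_cast hgen.trans htype
  have hle' (h2 : 2 ≤ e) : r * s + 1 ≤ e := by
    exact_mod_cast (add_le_add_left hgen 1).trans (htype' h2)
  norm_cast at hadd
  by_contra h
  rw [not_or] at h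
  have hr1 : 2 ≤ r := not_le.1 fun h' => h.1 (hcyclic h')
  have hs1 : 2 ≤ s := not_le.1 fun h' => h.2 (hcocyclic h')
  nlinarith [hle' (by nlinarith)]

end
end

section
/- Let R be a one-dimensional Cohen–Macaulay local ring with total ring of fractions F = Q(R), let f ∈ F with f ∉ R, and set I = R + Rf, a two-generated fractional ideal. Let J be any fractional ideal of R. Then the torsion submodule T(I ⊗_R J) of I ⊗_R J is isomorphic as an R-module to (J : I)/((R : I)J), via the map sending the class of c ∈ J : I to f ⊗ c − 1 ⊗ (cf). In particular, taking J = R : I, one has T(I ⊗_R (R : I)) ≅ (R : I²)/((R : I)²). -/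
open CategoryTheory TensorProduct

noncomputable section

namespace TwoGenerated

variable {R A : Type*} [CommRing R] [CommRing A] [Algebra R A]

lemma one_mem (f : A) : (1 : A) ∈ Submodule.span R {1, f} :=
  Submodule.subset_span (by simp)

lemma gen_mem (f : A) : f ∈ Submodule.span R {(1 : A), f} :=
  Submodule.subset_span (by simp)

lemma mem_colonSub_span_pair {f : A} {J : Submodule R A}
    {c : A} :
    c ∈ colonSub J (Submodule.span R {1, f}) ↔ c ∈ J ∧ c * f ∈ J := by
  refine ⟨fun hc => ⟨by simpa using hc 1 (one_mem f), hc f (gen_mem f)⟩, ?_⟩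
  rintro ⟨h1, hf⟩ y hy
  obtain ⟨r, s, rfl⟩ := Submodule.mem_span_pair.mp hy
  rw [mul_add, mul_smul_comm, mul_smul_comm, mul_one]
  exact J.add_mem (J.smul_mem r h1) (J.smul_mem s hf)

lemma colonSub_mul (M N P : Submodule R A) :
    colonSub M (N * P) = colonSub (colonSub M N) P := by
  ext x
  refine ⟨fun hx y hy z hz => ?_, fun hx y hy => ?_⟩
  · rw [mul_assoc, mul_comm y]
    exact hx _ (Submodule.mul_mem_mul hz hy)
  · induction hy using Submodule.mul_induction_on' with
    | mem_mul_mem n hn p hp =>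
      rw [mul_comm n, ← mul_assoc]
      exact hx p hp n hn
    | add a _ b _ ha hb => rw [mul_add]; exact M.add_mem ha hb

lemma smul_eq_zero_of_mem_nonZeroDivisors [IsFractionRing R A] {a : R}
    (ha : a ∈ nonZeroDivisors R) {x : A} (hx : a • x = 0) : x = 0 := by
  rw [Algebra.smul_def] at hx
  exact (IsLocalization.map_units A (⟨a, ha⟩ : nonZeroDivisors R)).mul_right_eq_zero.mp hx

section Abstract

/-! The ideals `I`, `J` and `J : I` are replaced by modules `M`, `N`, `C` with embeddings
`ι`, `κ`, `γ` into `A`, which keeps the tensor product independent of submodule instances. -/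

variable {M N C : Type*} [AddCommGroup M] [Module R M] [AddCommGroup N] [Module R N]
  [AddCommGroup C] [Module R C]

/-- The map `c ↦ v ⊗ α c - u ⊗ β c`. -/
def torsionMap (u v : M) (α β : C →ₗ[R] N) : C →ₗ[R] M ⊗[R] N :=
  TensorProduct.mk R M N v ∘ₗ α - TensorProduct.mk R M N u ∘ₗ β

lemma torsionMap_apply (u v : M) (α β : C →ₗ[R] N) (c : C) :
    torsionMap u v α β c = v ⊗ₜ[R] α c - u ⊗ₜ[R] β c :=
  rfl

lemma exists_tmul_add_tmul {u v : M} (hspan : ∀ y : M, ∃ r s : R, r • u + s • v = y)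
    (x : M ⊗[R] N) : ∃ a b : N, x = u ⊗ₜ[R] a + v ⊗ₜ[R] b := by
  induction x using TensorProduct.induction_on with
  | zero => exact ⟨0, 0, by simp⟩
  | tmul y j =>
    obtain ⟨r, s, rfl⟩ := hspan y
    exact ⟨r • j, s • j, by
      rw [TensorProduct.add_tmul, TensorProduct.smul_tmul, TensorProduct.smul_tmul]⟩
  | add x y hx hy =>
    obtain ⟨a, b, rfl⟩ := hx
    obtain ⟨c, d, rfl⟩ := hy
    exact ⟨a + c, b + d, by rw [TensorProduct.tmul_add, TensorProduct.tmul_add]; abel⟩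

variable {ι : M →ₗ[R] A} {κ : N →ₗ[R] A} {γ : C →ₗ[R] A} {f : A} {u v : M}
  {α β : C →ₗ[R] N} {J : Submodule R A}

lemma range_torsionMap [IsFractionRing R A]
    (hspan : ∀ y : M, ∃ r s : R, r • u + s • v = y)
    (hι : Function.Injective ι) (hu : ι u = 1) (hv : ι v = f)
    (hκ : Function.Injective κ) (hJ : LinearMap.range κ = J)
    (hγ : LinearMap.range γ = colonSub J (Submodule.span R {1, f}))
    (hα : ∀ c, κ (α c) = γ c) (hβ : ∀ c, κ (β c) = γ c * f) :
    LinearMap.range (torsionMap u v α β) = Submodule.torsion R (M ⊗[R] N) := by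
  apply le_antisymm
  · rintro _ ⟨c, rfl⟩
    obtain ⟨⟨a, s⟩, has⟩ := IsLocalization.surj (nonZeroDivisors R) f
    have hsf : (s : R) • f = a • (1 : A) := by
      rw [Algebra.smul_def, Algebra.smul_def, mul_one, mul_comm, has]
    have hsv : (s : R) • v = a • u := hι (by rw [map_smul, map_smul, hu, hv, hsf])
    have hsc : a • α c = (s : R) • β c := hκ (by
      rw [map_smul, map_smul, hα, hβ, ← mul_smul_comm, hsf, mul_smul_comm, mul_one])
    rw [Submodule.mem_torsion_iff]
    refine ⟨s, ?_⟩
    rw [Submonoid.smul_def, torsionMap_apply, smul_sub, TensorProduct.smul_tmul',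
      ← TensorProduct.tmul_smul, hsv, TensorProduct.smul_tmul, hsc, sub_self]
  · intro x hx
    obtain ⟨s, hs⟩ := (Submodule.mem_torsion_iff x).mp hx
    obtain ⟨a, b, rfl⟩ := exists_tmul_add_tmul hspan x
    have hab : κ a + f * κ b = 0 := by
      refine smul_eq_zero_of_mem_nonZeroDivisors s.2 ?_
      have := congrArg (TensorProduct.lift ((LinearMap.mul R A).compl₁₂ ι κ)) hs
      rw [map_zero, Submonoid.smul_def, map_smul] at this
      simpa [hu, hv] using this
    have hb : κ b * f = κ (-a) := by
      rw [map_neg, mul_comm]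
      exact eq_neg_of_add_eq_zero_right hab
    obtain ⟨c, hc⟩ : κ b ∈ LinearMap.range γ := by
      rw [hγ, mem_colonSub_span_pair, hb, ← hJ]
      exact ⟨⟨b, rfl⟩, ⟨-a, rfl⟩⟩
    refine ⟨c, ?_⟩
    rw [torsionMap_apply, hκ ((hα c).trans hc), hκ ((hβ c).trans (hc ▸ hb)),
      TensorProduct.tmul_neg]
    abel

/-- The coefficient of `f` of an element of `R + Rf` is well defined modulo `R : (R + Rf)`. -/
lemma exists_coeffMap (hspan : ∀ y : M, ∃ r s : R, r • u + s • v = y)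
    (hu : ι u = 1) (hv : ι v = f) (hJ : LinearMap.range κ = J) :
    ∃ ψ : M ⊗[R] N →ₗ[R] A ⧸ (colonSub (1 : Submodule R A) (Submodule.span R {1, f}) * J),
      ∀ j : N, ψ (u ⊗ₜ[R] j) = 0 ∧ ψ (v ⊗ₜ[R] j) = Submodule.Quotient.mk (κ j) := by
  set Q := colonSub (1 : Submodule R A) (Submodule.span R {1, f}) * J
  let π : R × R →ₗ[R] M :=
    (LinearMap.toSpanSingleton R _ u).coprod (LinearMap.toSpanSingleton R _ v)
  let φ : R × R →ₗ[R] N →ₗ[R] A ⧸ Q :=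
    (LinearMap.toSpanSingleton R _ (Q.mkQ ∘ₗ κ)) ∘ₗ LinearMap.snd R R R
  have hπ : Function.Surjective π := by
    intro y
    obtain ⟨r, s, rfl⟩ := hspan y
    exact ⟨(r, s), rfl⟩
  have hker : LinearMap.ker π ≤ LinearMap.ker φ := by
    rintro ⟨r, s⟩ h
    have h0 : r • (1 : A) + s • f = 0 := by
      have h' : r • u + s • v = 0 := LinearMap.mem_ker.mp h
      rw [← hu, ← hv, ← map_smul, ← map_smul, ← map_add, h', map_zero]
    have hs : algebraMap R A s ∈
        colonSub (1 : Submodule R A) (Submodule.span R {1, f}) := by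
      refine mem_colonSub_span_pair.mpr ⟨Submodule.mem_one.mpr ⟨s, rfl⟩,
        Submodule.mem_one.mpr ⟨-r, ?_⟩⟩
      rw [← Algebra.smul_def, eq_neg_of_add_eq_zero_right h0, map_neg, Algebra.smul_def, mul_one]
    refine LinearMap.mem_ker.mpr (LinearMap.ext fun j => ?_)
    change s • Q.mkQ (κ j) = 0
    rw [← map_smul, Submodule.mkQ_apply, Submodule.Quotient.mk_eq_zero, Algebra.smul_def]
    exact Submodule.mul_mem_mul hs (hJ ▸ ⟨j, rfl⟩)
  let g := (LinearMap.ker π).liftQ φ hker ∘ₗ (π.quotKerEquivOfSurjective hπ).symm.toLinearMap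
  have hg (p : R × R) : g (π p) = φ p := by
    have : (π.quotKerEquivOfSurjective hπ).symm (π p) = Submodule.Quotient.mk p := by
      rw [LinearEquiv.symm_apply_eq]; rfl
    simp only [g, LinearMap.comp_apply, LinearEquiv.coe_coe, this]
    rfl
  have hπu : π (1, 0) = u := by simp [π]
  have hπv : π (0, 1) = v := by simp [π]
  refine ⟨TensorProduct.lift g, fun j => ⟨?_, ?_⟩⟩
  · rw [TensorProduct.lift.tmul, ← hπu, hg]
    simp [φ]
  · rw [TensorProduct.lift.tmul, ← hπv, hg]
    simp [φ]

lemma ker_torsionMap (hspan : ∀ y : M, ∃ r s : R, r • u + s • v = y)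
    (hι : Function.Injective ι) (hu : ι u = 1) (hv : ι v = f)
    (hκ : Function.Injective κ) (hJ : LinearMap.range κ = J)
    (hγinj : Function.Injective γ)
    (hγ : LinearMap.range γ = colonSub J (Submodule.span R {1, f}))
    (hα : ∀ c, κ (α c) = γ c) (hβ : ∀ c, κ (β c) = γ c * f) :
    LinearMap.ker (torsionMap u v α β) =
      (colonSub (1 : Submodule R A) (Submodule.span R {1, f}) * J).comap γ := by
  apply le_antisymm
  · intro c hc
    obtain ⟨ψ, hψ⟩ := exists_coeffMap hspan hu hv hJ
    have h := congrArg ψ (LinearMap.mem_ker.mp hc)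
    rwa [torsionMap_apply, map_sub, map_zero, (hψ _).1, (hψ _).2, sub_zero,
      Submodule.Quotient.mk_eq_zero, hα] at h
  · intro c h
    have key : ∀ x ∈ colonSub (1 : Submodule R A) (Submodule.span R {1, f}) * J,
        ∃ d, γ d = x ∧ torsionMap u v α β d = 0 := by
      intro x hx
      induction hx using Submodule.mul_induction_on' with
      | mem_mul_mem m hm j hj =>
        obtain ⟨h1, h2⟩ := mem_colonSub_span_pair.mp hm
        obtain ⟨s, rfl⟩ := Submodule.mem_one.mp h1
        obtain ⟨r, hr⟩ := Submodule.mem_one.mp h2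
        obtain ⟨n, rfl⟩ : j ∈ LinearMap.range κ := hJ ▸ hj
        have hsn : algebraMap R A s * κ n = κ (s • n) := by
          rw [map_smul, Algebra.smul_def]
        have hrn : algebraMap R A s * κ n * f = κ (r • n) := by
          rw [mul_right_comm, ← hr, map_smul, Algebra.smul_def]
        obtain ⟨d, hd⟩ : algebraMap R A s * κ n ∈ LinearMap.range γ := by
          rw [hγ, mem_colonSub_span_pair, hrn, hsn, ← hJ]
          exact ⟨⟨_, rfl⟩, ⟨_, rfl⟩⟩
        have hsv : s • v = r • u := hι (by
          rw [map_smul, map_smul, hu, hv, Algebra.smul_def, Algebra.smul_def, mul_one, hr])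
        refine ⟨d, hd, ?_⟩
        rw [torsionMap_apply, hκ ((hα d).trans (hd.trans hsn)),
          hκ ((hβ d).trans (hd ▸ hrn)), ← TensorProduct.smul_tmul, ← TensorProduct.smul_tmul,
          hsv, sub_self]
      | add a _ b _ ha hb =>
        obtain ⟨d, rfl, hd⟩ := ha
        obtain ⟨e, rfl, he⟩ := hb
        exact ⟨d + e, map_add _ _ _, by rw [map_add, hd, he, add_zero]⟩
    obtain ⟨d, hd, hd0⟩ := key _ h
    exact LinearMap.mem_ker.mpr (hγinj hd ▸ hd0)

lemma exists_torsionEquiv [IsFractionRing R A]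
    (hspan : ∀ y : M, ∃ r s : R, r • u + s • v = y)
    (hι : Function.Injective ι) (hu : ι u = 1) (hv : ι v = f)
    (hκ : Function.Injective κ) (hJ : LinearMap.range κ = J)
    (hγinj : Function.Injective γ)
    (hγ : LinearMap.range γ = colonSub J (Submodule.span R {1, f}))
    (hα : ∀ c, κ (α c) = γ c) (hβ : ∀ c, κ (β c) = γ c * f) :
    ∃ e : (C ⧸ (colonSub (1 : Submodule R A) (Submodule.span R {1, f}) * J).comap γ) ≃ₗ[R]
        Submodule.torsion R (M ⊗[R] N),
      ∀ c : C, (e (Submodule.Quotient.mk c) : M ⊗[R] N) = v ⊗ₜ[R] α c - u ⊗ₜ[R] β c :=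
  ⟨Submodule.quotEquivOfEq _ _
      (ker_torsionMap hspan hι hu hv hκ hJ hγinj hγ hα hβ).symm ≪≫ₗ
    (torsionMap u v α β).quotKerEquivRange ≪≫ₗ
    LinearEquiv.ofEq _ _ (range_torsionMap hspan hι hu hv hκ hJ hγ hα hβ), fun _ => rfl⟩

end Abstract

lemma exists_torsionEquiv_colonSub [IsFractionRing R A] (f : A) (J : Submodule R A) :
    ∃ e : (colonSub J (Submodule.span R {1, f}) ⧸
        (colonSub (1 : Submodule R A) (Submodule.span R {1, f}) * J).comap
          (colonSub J (Submodule.span R {1, f})).subtype) ≃ₗ[R]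
        Submodule.torsion R (Submodule.span R {1, f} ⊗[R] J),
      ∀ (c : A) (hc : c ∈ colonSub J (Submodule.span R {1, f})),
        (e (Submodule.Quotient.mk ⟨c, hc⟩) : Submodule.span R {1, f} ⊗[R] J) =
          (⟨f, gen_mem f⟩ : Submodule.span R {1, f}) ⊗ₜ[R]
            (⟨c, (mem_colonSub_span_pair.mp hc).1⟩ : J) -
          (⟨1, one_mem f⟩ : Submodule.span R {1, f}) ⊗ₜ[R]
            (⟨c * f, (mem_colonSub_span_pair.mp hc).2⟩ : J) := by
  obtain ⟨e, he⟩ := exists_torsionEquiv (R := R) (A := A)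
    (ι := (Submodule.span R {1, f}).subtype) (κ := J.subtype)
    (γ := (colonSub J (Submodule.span R {1, f})).subtype) (f := f) (J := J)
    (u := ⟨1, one_mem f⟩) (v := ⟨f, gen_mem f⟩)
    (α := (colonSub J (Submodule.span R {1, f})).subtype.codRestrict J
      fun c => (mem_colonSub_span_pair.mp c.2).1)
    (β := (LinearMap.mulRight R f ∘ₗ
      (colonSub J (Submodule.span R {1, f})).subtype).codRestrict J
      fun c => (mem_colonSub_span_pair.mp c.2).2)
    (fun y => (Submodule.mem_span_pair.mp y.2).imp fun _ h => h.imp fun _ h => Subtype.ext h)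
    Subtype.val_injective rfl rfl Subtype.val_injective J.range_subtype
    Subtype.val_injective (Submodule.range_subtype _) (fun _ => rfl) (fun _ => rfl)
  exact ⟨e, fun c hc => he ⟨c, hc⟩⟩

end TwoGenerated

/-- (Proposition 6.3 and Corollary 6.4) Let `R` be a one-dimensional
Cohen–Macaulay local ring, `F = Q(R)`, `f ∈ F ∖ R`, `I = R + Rf = span {1, f}` and `J` a
fractional ideal. Then `T(I ⊗_R J) ≅ (J : I)/((R : I)J)` via the class of `c` mapping to
`f ⊗ c − 1 ⊗ cf`; in particular `T(I ⊗_R (R : I)) ≅ (R : I²)/((R : I)²)`. -/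
theorem stmt19 (R : Type u) [CommRing R] [IsLocalRing R] (hCM : IsOneDimCMLocal R)
    (f : FractionRing R) (hf : f ∉ Set.range (algebraMap R (FractionRing R)))
    (J : Submodule R (FractionRing R)) (hJfg : J.FG)
    (hJnzd : ∃ r ∈ nonZeroDivisors R, algebraMap R (FractionRing R) r ∈ J) :
    (∃ e : (colonSub J (Submodule.span R {(1 : FractionRing R), f}) ⧸
        ((colonSub (1 : Submodule R (FractionRing R))
            (Submodule.span R {(1 : FractionRing R), f}) * J).comap
          (colonSub J (Submodule.span R {(1 : FractionRing R), f})).subtype)) ≃ₗ[R]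
        ↥(Submodule.torsion R
          (↥(Submodule.span R {(1 : FractionRing R), f}) ⊗[R] ↥J)),
      ∀ (c : FractionRing R)
        (hc : c ∈ colonSub J (Submodule.span R {(1 : FractionRing R), f})),
        ((e (Submodule.Quotient.mk ⟨c, hc⟩) :
            ↥(Submodule.span R {(1 : FractionRing R), f}) ⊗[R] ↥J)) =
          (⟨f, Submodule.subset_span (by simp)⟩ :
              ↥(Submodule.span R {(1 : FractionRing R), f})) ⊗ₜ[R]
            (⟨c, by simpa using hc 1 (Submodule.subset_span (by simp))⟩ : ↥J) -
          (⟨1, Submodule.subset_span (by simp)⟩ :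
              ↥(Submodule.span R {(1 : FractionRing R), f})) ⊗ₜ[R]
            (⟨c * f, hc f (Submodule.subset_span (by simp))⟩ : ↥J)) ∧
    Nonempty
      ((colonSub (1 : Submodule R (FractionRing R))
          (Submodule.span R {(1 : FractionRing R), f} *
            Submodule.span R {(1 : FractionRing R), f}) ⧸
        ((colonSub (1 : Submodule R (FractionRing R))
            (Submodule.span R {(1 : FractionRing R), f}) *
          colonSub (1 : Submodule R (FractionRing R))
            (Submodule.span R {(1 : FractionRing R), f})).comap
          (colonSub (1 : Submodule R (FractionRing R))
            (Submodule.span R {(1 : FractionRing R), f} *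
              Submodule.span R {(1 : FractionRing R), f})).subtype)) ≃ₗ[R]
      ↥(Submodule.torsion R
        (↥(Submodule.span R {(1 : FractionRing R), f}) ⊗[R]
          ↥(colonSub (1 : Submodule R (FractionRing R))
            (Submodule.span R {(1 : FractionRing R), f}))))) := by
  refine ⟨TwoGenerated.exists_torsionEquiv_colonSub f J, ?_⟩
  rw [TwoGenerated.colonSub_mul]
  exact ⟨(TwoGenerated.exists_torsionEquiv_colonSub f _).choose⟩

end
end
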